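/- arXiv:1911.06403 — 2 statements merged into one kernel-verified Lean document; each statement's English description precedes it below -/
import Mathlib

section
/- Let 𝒢 be a hereditary class of graphs that is closed under removing edges, let f(x) = cx be a linear function for some constant c, and let g be an arbitrary function. If for every graph G in 𝒢 with n vertices and m edges one has cr(G) ≥ f(m) − g(n), then for every positive integer k and every G ∈ 𝒢, cr_k(G) ≥ f(m) − k·g(n). -/
open SimpleGraph

/-- A drawing of a simple graph `G` in the plane: an injective placement of the
vertices, together with, for each (oriented) edge, a simple arc between the images
of its endpoints that avoids all vertex images in its interior; the two
orientations of an edge are drawn by the same arc (reversed). -/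
structure Drawing {V : Type*} (G : SimpleGraph V) where
  pos : V → ℝ × ℝ
  pos_inj : Function.Injective pos
  arc : ∀ ⦃u v : V⦄, G.Adj u v → Path (pos u) (pos v)
  arc_symm : ∀ ⦃u v : V⦄ (h : G.Adj u v), arc h.symm = (arc h).symm
  arc_inj : ∀ ⦃u v : V⦄ (h : G.Adj u v), Function.Injective (arc h)
  arc_avoid : ∀ ⦃u v : V⦄ (h : G.Adj u v) (w : V) (t : unitInterval),
    arc h t = pos w → t = 0 ∨ t = 1

/-- The interior of the curve representing an edge `e` in a drawing:
the image of the open arc, excluding the endpoints. -/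
def Drawing.edgeInterior {V : Type*} {G : SimpleGraph V} (D : Drawing G) (e : Sym2 V) :
    Set (ℝ × ℝ) :=
  ⋃ (u : V) (v : V) (h : G.Adj u v) (_ : e = s(u, v)),
    (D.arc h) '' {t : unitInterval | t ≠ 0 ∧ t ≠ 1}

/-- Two edges of `G` cross in the drawing `D` if they are distinct edges of `G`
whose interiors meet. -/
def Drawing.Crosses {V : Type*} {G : SimpleGraph V} (D : Drawing G) (e f : Sym2 V) : Prop :=
  e ∈ G.edgeSet ∧ f ∈ G.edgeSet ∧ e ≠ f ∧ (D.edgeInterior e ∩ D.edgeInterior f).Nonempty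

/-- The number of crossings of a drawing: the number of unordered pairs of
distinct edges that cross (in a simple/nice drawing every crossing pair of edges
crosses exactly once). -/
noncomputable def Drawing.crossCount {V : Type*} {G : SimpleGraph V} (D : Drawing G) : ℕ :=
  {p : Sym2 V × Sym2 V | D.Crosses p.1 p.2}.ncard / 2

/-- The crossing number `cr(G)`: the minimum number of crossings over all drawings
of `G` in the plane. -/
noncomputable def crossingNumber {V : Type*} (G : SimpleGraph V) : ℕ :=
  sInf {n : ℕ | ∃ D : Drawing G, D.crossCount = n}

/-- The `k`-planar crossing number `cr_k(G)`: the minimum of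
`cr(G₁) + ⋯ + cr(G_k)` over all decompositions of the edge set of `G` into `k`
edge-disjoint subgraphs `G₁, …, G_k` on the same vertex set. -/
noncomputable def kCrossingNumber {V : Type*} (k : ℕ) (G : SimpleGraph V) : ℕ :=
  sInf {n : ℕ | ∃ f : Fin k → SimpleGraph V,
    (⨆ i, f i) = G ∧
    (∀ i j : Fin k, i ≠ j → Disjoint (f i).edgeSet (f j).edgeSet) ∧
    n = ∑ i : Fin k, crossingNumber (f i)}

theorem edgeSet_iSup_eq_iUnion {V ι : Type*} (f : ι → SimpleGraph V) :
    (⨆ i, f i).edgeSet = ⋃ i, (f i).edgeSet := by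
  ext e
  induction e using Sym2.ind with
  | _ u v => simp [SimpleGraph.iSup_adj]

/-- The edge count of a finite edge-disjoint union is the sum of the edge counts. -/
theorem ncard_edgeSet_iSup {V ι : Type*} [Finite V] [Fintype ι] (f : ι → SimpleGraph V)
    (hf : ∀ i j, i ≠ j → Disjoint (f i).edgeSet (f j).edgeSet) :
    (⨆ i, f i).edgeSet.ncard = ∑ i, (f i).edgeSet.ncard := by
  rw [edgeSet_iSup_eq_iUnion, Set.ncard_iUnion_of_finite (fun i => Set.toFinite _)
    (fun i j hij => hf i j hij), finsum_eq_sum_of_fintype]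

/-- For `k ≥ 1`, the minimum defining the `k`-planar crossing number is attained. -/
theorem exists_decomposition_kCrossingNumber_eq {V : Type*} {k : ℕ} (hk : 0 < k)
    (G : SimpleGraph V) :
    ∃ f : Fin k → SimpleGraph V,
      (⨆ i, f i) = G ∧
      (∀ i j : Fin k, i ≠ j → Disjoint (f i).edgeSet (f j).edgeSet) ∧
      kCrossingNumber k G = ∑ i : Fin k, crossingNumber (f i) := by
  refine Nat.sInf_mem (s := {n : ℕ | ∃ f : Fin k → SimpleGraph V, (⨆ i, f i) = G ∧
    (∀ i j : Fin k, i ≠ j → Disjoint (f i).edgeSet (f j).edgeSet) ∧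
    n = ∑ i : Fin k, crossingNumber (f i)}) ?_
  refine ⟨_, fun i => if i = ⟨0, hk⟩ then G else ⊥, ?_, ?_, rfl⟩
  · refine le_antisymm (iSup_le fun i => ?_) (le_iSup_of_le ⟨0, hk⟩ (by simp))
    by_cases hi : i = ⟨0, hk⟩ <;> simp [hi]
  · intro i j hij
    by_cases hi : i = ⟨0, hk⟩
    · have hj : j ≠ ⟨0, hk⟩ := fun h => hij (hi.trans h.symm)
      simp [hj]
    · simp [hi]

/-- If `𝒢` is a hereditary class of graphs closed under removing edges,
`f(x) = c·x` is a linear function and `g` is arbitrary, and `cr(G) ≥ f(m) − g(n)`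
for all `G ∈ 𝒢`, then `cr_k(G) ≥ f(m) − k·g(n)` for all `G ∈ 𝒢` and all `k ≥ 1`. -/
theorem hereditary_kplanar_lower_bound
    (𝒢 : ∀ ⦃n : ℕ⦄, SimpleGraph (Fin n) → Prop)
    (hHered : ∀ ⦃n m : ℕ⦄ (G : SimpleGraph (Fin n)) (H : SimpleGraph (Fin m)),
      𝒢 G → Nonempty (H ↪g G) → 𝒢 H)
    (hEdgeDel : ∀ ⦃n : ℕ⦄ (G H : SimpleGraph (Fin n)), 𝒢 G → H ≤ G → 𝒢 H)
    (c : ℝ) (g : ℕ → ℝ)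
    (hlow : ∀ ⦃n : ℕ⦄ (G : SimpleGraph (Fin n)), 𝒢 G →
      c * (G.edgeSet.ncard : ℝ) - g n ≤ (crossingNumber G : ℝ))
    (k : ℕ) (hk : 0 < k) {n : ℕ} (G : SimpleGraph (Fin n)) (hG : 𝒢 G) :
    c * (G.edgeSet.ncard : ℝ) - (k : ℝ) * g n ≤ (kCrossingNumber k G : ℝ) := by
  obtain ⟨f, hsup, hdisj, heq⟩ := exists_decomposition_kCrossingNumber_eq hk G
  have hle : ∀ i, f i ≤ G := fun i => hsup ▸ le_iSup f i
  have hcard : G.edgeSet.ncard = ∑ i, (f i).edgeSet.ncard := by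
    rw [← ncard_edgeSet_iSup f hdisj, hsup]
  calc c * (G.edgeSet.ncard : ℝ) - (k : ℝ) * g n
      = ∑ i, (c * ((f i).edgeSet.ncard : ℝ) - g n) := by
        rw [hcard, Finset.sum_sub_distrib, ← Finset.mul_sum]
        simp
    _ ≤ ∑ i, (crossingNumber (f i) : ℝ) :=
        Finset.sum_le_sum fun i _ => hlow (f i) (hEdgeDel G (f i) hG (hle i))
    _ = (kCrossingNumber k G : ℝ) := by rw [heq]; push_cast; rfl
end

section
/- For every bipartite graph G with n ≥ 4 vertices and m edges, cr_2(G) ≥ 3m − 17n + 38. -/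
open SimpleGraph

/-- The unit vector of the square grid in one of the two directions. -/
def gridDir (b : Bool) : ℤ × ℤ := if b then (1, 0) else (0, 1)

/-- Adjacency in the square grid `ℤ × ℤ`. -/
def GridAdj (z w : ℤ × ℤ) : Prop := ∃ b, w = z + gridDir b ∨ z = w + gridDir b

/-- Reachability in the square grid inside the set `S`. -/
def GridReach (S : Set (ℤ × ℤ)) : ℤ × ℤ → ℤ × ℤ → Prop :=
  Relation.ReflTransGen fun a b => GridAdj a b ∧ a ∈ S ∧ b ∈ S

/-- A set of grid points is connected if any two of its points are joined inside it. -/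
def GridConn (S : Set (ℤ × ℤ)) : Prop := ∀ z ∈ S, ∀ w ∈ S, GridReach S z w

/-- The mod 2 boundary of an edge chain of the grid; the edge `(b, z)` joins `z` to
`z + gridDir b`. -/
def gridBoundary (c : Bool × (ℤ × ℤ) → ZMod 2) (u : ℤ × ℤ) : ZMod 2 :=
  ∑ b, (c (b, u) + c (b, u - gridDir b))

lemma GridAdj.symm {z w : ℤ × ℤ} (h : GridAdj z w) : GridAdj w z := by
  obtain ⟨b, h | h⟩ := h
  exacts [⟨b, Or.inr h⟩, ⟨b, Or.inl h⟩]

lemma GridReach.symm {S : Set (ℤ × ℤ)} {z w : ℤ × ℤ} (h : GridReach S z w) :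
    GridReach S w z := by
  induction h with
  | refl => exact Relation.ReflTransGen.refl
  | tail _ h ih => exact Relation.ReflTransGen.head ⟨h.1.symm, h.2.2, h.2.1⟩ ih

lemma GridReach.mono {S T : Set (ℤ × ℤ)} (hST : S ⊆ T) {z w : ℤ × ℤ} (h : GridReach S z w) :
    GridReach T z w :=
  Relation.ReflTransGen.mono (fun _ _ h => ⟨h.1, hST h.2.1, hST h.2.2⟩) _ _ h

/-- A cycle of the grid is the boundary of a set of cells; the cell `z` has lower left corner `z`,
and the edge `(b, z)` separates the cells `z` and `z - gridDir !b`. -/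
lemma exists_cell_potential (c : Bool × (ℤ × ℤ) → ZMod 2) (M : ℤ)
    (hM : ∀ b z, z.2 ≤ M → c (b, z) = 0) (hc : ∀ u, gridBoundary c u = 0) :
    ∃ φ : ℤ × ℤ → ZMod 2, ∀ b z, c (b, z) = φ z + φ (z - gridDir !b) := by
  let φ : ℤ × ℤ → ZMod 2 := fun z => ∑ k ∈ Finset.Ioc M z.2, c (true, (z.1, k))
  have hlow : ∀ i j, j ≤ M → φ (i, j) = 0 := by
    intro i j hj
    simp [φ, Finset.Ioc_eq_empty_of_le hj]
  have hstep : ∀ i j, φ (i, j) = φ (i, j - 1) + c (true, (i, j)) := by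
    intro i j
    rcases le_or_gt j M with hj | hj
    · rw [hlow i j hj, hlow i (j - 1) (by omega), hM _ _ hj]; simp
    · have : Finset.Ioc M j = insert j (Finset.Ioc M (j - 1)) := by
        ext x; simp only [Finset.mem_Ioc, Finset.mem_insert]; omega
      simp only [φ]
      rw [this, Finset.sum_insert (by simp), add_comm]
  have hside : ∀ i j, c (false, (i, j)) = φ (i, j) + φ (i - 1, j) := by
    intro i j
    rcases le_or_gt j M with hj | hj
    · rw [hlow i j hj, hlow _ j hj, hM _ _ hj]; simp
    · refine Int.leInduction (m := M)
        (motive := fun j _ => c (false, (i, j)) = φ (i, j) + φ (i - 1, j))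
        ?_ ?_ j hj.le
      · rw [hlow i M le_rfl, hlow _ M le_rfl, hM _ _ le_rfl]; simp
      · intro k _ ih
        rw [hstep i, hstep (i - 1)]
        have h := hc (i, k + 1)
        simp only [gridBoundary, gridDir, Fintype.sum_bool, if_true, Prod.mk_sub_mk, sub_zero,
          Bool.false_eq_true, if_false, add_sub_cancel_right] at h ⊢
        have h2 : ∀ a b c d e f : ZMod 2, a + b + (c + d) = 0 → d = e + f →
          c = e + a + (f + b) := by decide
        exact h2 _ _ _ _ _ _ h ih
  refine ⟨φ, ?_⟩
  rintro (_ | _) ⟨i, j⟩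
  · simpa [gridDir] using hside i j
  · have := hstep i j
    simp only [gridDir, Bool.not_true, Bool.false_eq_true, if_false, Prod.mk_sub_mk, sub_zero]
    rw [this]
    generalize φ (i, j - 1) = a
    generalize c (true, (i, j)) = b
    revert a b; decide

lemma gridBoundary_add (c d : Bool × (ℤ × ℤ) → ZMod 2) (u : ℤ × ℤ) :
    gridBoundary (c + d) u = gridBoundary c u + gridBoundary d u := by
  simp only [gridBoundary, Fintype.sum_bool, Pi.add_apply]; ring

lemma gridBoundary_sum {ι : Type*} (s : Finset ι) (z : ι → ZMod 2)
    (c : ι → Bool × (ℤ × ℤ) → ZMod 2) (u : ℤ × ℤ) :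
    gridBoundary (fun e => ∑ i ∈ s, z i * c i e) u = ∑ i ∈ s, z i * gridBoundary (c i) u := by
  simp only [gridBoundary, Fintype.sum_bool, mul_add, Finset.sum_add_distrib]

lemma gridBoundary_single (e : Bool × (ℤ × ℤ)) (u : ℤ × ℤ) :
    gridBoundary (fun x => if x = e then 1 else 0) u =
      (if u = e.2 then 1 else 0) + (if u = e.2 + gridDir e.1 then 1 else 0) := by
  obtain ⟨b, z⟩ := e
  cases b <;> simp [gridBoundary, sub_eq_iff_eq_add]

/-- Two points joined inside `S` bound a chain supported on the edges inside `S`. -/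
lemma GridReach.exists_chain {S : Set (ℤ × ℤ)} {z w : ℤ × ℤ} (h : GridReach S z w) :
    ∃ c : Bool × (ℤ × ℤ) → ZMod 2,
      (∀ e, c e ≠ 0 → e.2 ∈ S ∧ e.2 + gridDir e.1 ∈ S) ∧
      ∀ u, gridBoundary c u = (if u = z then 1 else 0) + (if u = w then 1 else 0) := by
  induction h with
  | refl => 
    refine ⟨0, by simp, fun u => ?_⟩
    rw [CharTwo.add_self_eq_zero]; simp [gridBoundary]
  | @tail x y _ h ih =>
    obtain ⟨c, hc, hb⟩ := ih
    obtain ⟨⟨b, hxy⟩, hx, hy⟩ := h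
    obtain ⟨e, he, heS⟩ : ∃ e : Bool × (ℤ × ℤ),
        ((e.2 = x ∧ e.2 + gridDir e.1 = y) ∨ (e.2 = y ∧ e.2 + gridDir e.1 = x)) ∧
        (e.2 ∈ S ∧ e.2 + gridDir e.1 ∈ S) := by
      rcases hxy with h | h
      · exact ⟨(b, x), Or.inl ⟨rfl, h.symm⟩, hx, by simpa [← h] using hy⟩
      · exact ⟨(b, y), Or.inr ⟨rfl, h.symm⟩, hy, by simpa [← h] using hx⟩
    refine ⟨c + fun t => if t = e then 1 else 0, ?_, ?_⟩
    · intro t ht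
      by_cases hte : t = e
      · exact hte ▸ heS
      · exact hc t (by simpa [hte] using ht)
    · intro u
      rw [gridBoundary_add, hb, gridBoundary_single]
      have key : ∀ a b c : ZMod 2, a + b + (b + c) = a + c := by decide
      have key' : ∀ a b c : ZMod 2, a + b + (c + b) = a + c := by decide
      rcases he with ⟨h1, h2⟩ | ⟨h1, h2⟩ <;> rw [h2, h1]
      · exact key _ _ _
      · exact key' _ _ _

section EdgeSpace

variable {W : Type*} [DecidableEq W]

/-- The mod 2 boundary map from the edge space of a graph to its vertex space. -/
def edgeBoundary (F : Finset (W × W)) : (F → ZMod 2) →ₗ[ZMod 2] (W → ZMod 2) where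
  toFun z w := ∑ f : F, ((if f.1.1 = w then 1 else 0) + (if f.1.2 = w then 1 else 0)) * z f
  map_add' x y := by
    ext w; simp only [Pi.add_apply, mul_add, Finset.sum_add_distrib]
  map_smul' a x := by
    ext w
    simp only [Pi.smul_apply, smul_eq_mul, RingHom.id_apply, Finset.mul_sum]
    exact Finset.sum_congr rfl fun _ _ => by ring

lemma edgeBoundary_apply (F : Finset (W × W)) (z : F → ZMod 2) (w : W) :
    edgeBoundary F z w =
      ∑ f : F, ((if f.1.1 = w then 1 else 0) + (if f.1.2 = w then 1 else 0)) * z f := rfl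

lemma sum_edgeBoundary [Fintype W] (F : Finset (W × W)) (z : F → ZMod 2) :
    ∑ w, edgeBoundary F z w = 0 := by
  simp only [edgeBoundary_apply]
  rw [Finset.sum_comm]
  refine Finset.sum_eq_zero fun f _ => ?_
  rw [← Finset.sum_mul, Finset.sum_add_distrib]
  simp [CharTwo.add_self_eq_zero]

/-- The dimension of the cycle space is at least `|F| - |W| + 1`. -/
lemma card_lt_finrank_cycles_add [Fintype W] (F : Finset (W × W)) (hW : 0 < Fintype.card W) :
    F.card + 1 ≤ Module.finrank (ZMod 2) (LinearMap.ker (edgeBoundary F)) + Fintype.card W := by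
  have h1 := LinearMap.finrank_range_add_finrank_ker (edgeBoundary F)
  rw [Module.finrank_fintype_fun_eq_card, Fintype.card_coe] at h1
  have h2 : Module.finrank (ZMod 2) (LinearMap.range (edgeBoundary F)) < Fintype.card W := by
    rw [← Module.finrank_fintype_fun_eq_card (ZMod 2) (η := W)]
    refine Submodule.finrank_lt fun htop => ?_
    obtain ⟨w⟩ := Fintype.card_pos_iff.1 hW
    have : (Pi.single w 1 : W → ZMod 2) ∈ LinearMap.range (edgeBoundary F) := htop ▸ trivial
    obtain ⟨z, hz⟩ := this
    have := sum_edgeBoundary F z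
    rw [hz] at this
    simp at this
  omega

/-- A nonzero cycle of a simple bipartite graph has at least four edges. -/
lemma four_le_card_support_of_cycle (F : Finset (W × W)) (col : W → Bool)
    (hcol : ∀ f ∈ F, col f.1 = false ∧ col f.2 = true) (z : F → ZMod 2)
    (hz : edgeBoundary F z = 0) (hz0 : z ≠ 0) :
    4 ≤ (Finset.univ.filter fun f => z f ≠ 0).card := by
  have hne : ∀ f g : F, f.1.1 ≠ g.1.2 := by
    intro f g h
    have h1 := (hcol _ f.2).1
    rw [h, (hcol _ g.2).2] at h1
    simp at h1
  have other1 : ∀ f : F, z f ≠ 0 → ∃ g : F, z g ≠ 0 ∧ g.1.1 = f.1.1 ∧ g.1.2 ≠ f.1.2 := by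
    intro f hf
    by_contra! hcon
    have h := congrFun hz f.1.1
    rw [edgeBoundary_apply, Finset.sum_eq_single f] at h
    · rw [if_pos rfl, if_neg (hne f f).symm] at h
      simp at h; exact hf h
    · intro g _ hgf
      rw [if_neg (hne f g).symm]
      by_cases hg : g.1.1 = f.1.1
      · have : z g = 0 := by
          by_contra h0
          exact hgf (Subtype.ext (Prod.ext hg (hcon g h0 hg)))
        rw [this, mul_zero]
      · rw [if_neg hg]; simp
    · simp
  have other2 : ∀ f : F, z f ≠ 0 → ∃ g : F, z g ≠ 0 ∧ g.1.2 = f.1.2 ∧ g.1.1 ≠ f.1.1 := by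
    intro f hf
    by_contra! hcon
    have h := congrFun hz f.1.2
    rw [edgeBoundary_apply, Finset.sum_eq_single f] at h
    · rw [if_pos rfl, if_neg (hne f f)] at h
      simp at h; exact hf h
    · intro g _ hgf
      rw [if_neg (hne g f)]
      by_cases hg : g.1.2 = f.1.2
      · have : z g = 0 := by
          by_contra h0
          exact hgf (Subtype.ext (Prod.ext (hcon g h0 hg) hg))
        rw [this, mul_zero]
      · rw [if_neg hg]; simp
    · simp
  obtain ⟨f, hf⟩ := Function.ne_iff.1 hz0
  obtain ⟨g, hg, hg1, hg2⟩ := other1 f hf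
  obtain ⟨k, hk, hk2, hk1⟩ := other2 f hf
  obtain ⟨l, hl, hl1, hl2⟩ := other1 k hk
  have hsub : ({f, g, k, l} : Finset F) ⊆ Finset.univ.filter fun f => z f ≠ 0 := by
    intro x hx
    simp only [Finset.mem_insert, Finset.mem_singleton] at hx
    simp only [Finset.mem_filter, Finset.mem_univ, true_and]
    rcases hx with rfl | rfl | rfl | rfl <;> assumption
  refine le_trans ?_ (Finset.card_le_card hsub)
  have e1 : f ≠ g := by rintro rfl; exact hg2 rfl
  have e2 : f ≠ k := by rintro rfl; exact hk1 rfl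
  have e3 : f ≠ l := by rintro rfl; exact hl2 hk2.symm
  have e4 : g ≠ k := by rintro rfl; exact hk1 hg1
  have e5 : g ≠ l := by rintro rfl; exact hk1 (hl1.symm.trans hg1)
  have e6 : k ≠ l := by rintro rfl; exact hl2 rfl
  rw [Finset.card_insert_of_notMem (by simp [e1, e2, e3]),
    Finset.card_insert_of_notMem (by simp [e4, e5]),
    Finset.card_insert_of_notMem (by simp [e6]), Finset.card_singleton]

/-- **Euler's inequality**, algebraic form: if the cycle space of a simple bipartite graph is
spanned by the boundaries of faces, where each edge `f` separates the faces `l f` and `r f`,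
then the graph has at most `2 |W| - 4` edges. -/
theorem card_add_four_le_of_faces [Fintype W] {Face : Type*} [DecidableEq Face]
    (F : Finset (W × W)) (col : W → Bool)
    (hcol : ∀ f ∈ F, col f.1 = false ∧ col f.2 = true) (hW : 3 ≤ Fintype.card W)
    (l r : F → Face)
    (hface : ∀ x, edgeBoundary F
      (fun f => (if l f = x then 1 else 0) + (if r f = x then 1 else 0)) = 0)
    (hspan : ∀ z, edgeBoundary F z = 0 → ∃ y : Face → ZMod 2, ∀ f, z f = y (l f) + y (r f)) :
    F.card + 4 ≤ 2 * Fintype.card W := by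
  classical
  let b : Face → F → ZMod 2 :=
    fun x f => (if l f = x then 1 else 0) + (if r f = x then 1 else 0)
  let P : Finset Face := Finset.univ.image l ∪ Finset.univ.image r
  let P' : Finset Face := P.filter fun x => b x ≠ 0
  have hl : ∀ f, l f ∈ P := fun f => Finset.mem_union_left _ (Finset.mem_image_of_mem _ (by simp))
  have hr : ∀ f, r f ∈ P := fun f => Finset.mem_union_right _ (Finset.mem_image_of_mem _ (by simp))
  have hsum : ∀ (y : Face → ZMod 2) f, ∑ x ∈ P', y x * b x f = y (l f) + y (r f) := by
    intro y f
    rw [Finset.sum_filter_of_ne]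
    · simp only [b, mul_add, Finset.sum_add_distrib, mul_ite, mul_one, mul_zero]
      rw [Finset.sum_ite_eq, Finset.sum_ite_eq, if_pos (hl f), if_pos (hr f)]
    · intro x _ hx h0
      rw [h0] at hx; simp at hx
  have hcount : 4 * P'.card ≤ 2 * F.card := by
    calc 4 * P'.card = ∑ x ∈ P', 4 := by simp [mul_comm]
      _ ≤ ∑ x ∈ P', (Finset.univ.filter fun f => b x f ≠ 0).card :=
          Finset.sum_le_sum fun x hx => four_le_card_support_of_cycle F col hcol _ (hface x)
            (Finset.mem_filter.1 hx).2
      _ = ∑ f : F, (P'.filter fun x => b x f ≠ 0).card := by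
          simp only [Finset.card_filter]; rw [Finset.sum_comm]
      _ ≤ ∑ f : F, 2 := by
          refine Finset.sum_le_sum fun f _ => ?_
          refine le_trans (Finset.card_le_card (t := {l f, r f}) ?_) Finset.card_le_two
          intro x hx
          have := (Finset.mem_filter.1 hx).2
          simp only [Finset.mem_insert, Finset.mem_singleton]
          by_contra! h
          exact this (by simp [b, h.1.symm, h.2.symm])
      _ = 2 * F.card := by simp [mul_comm]
  have hdim := card_lt_finrank_cycles_add F (by omega)
  rcases P'.eq_empty_or_nonempty with hP | ⟨x₀, hx₀⟩
  · have : LinearMap.ker (edgeBoundary F) = ⊥ := by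
      rw [eq_bot_iff]
      intro z hz
      obtain ⟨y, hy⟩ := hspan z hz
      rw [Submodule.mem_bot]
      ext f
      rw [hy f, ← hsum y f, hP]; simp
    rw [this, finrank_bot] at hdim
    omega
  · have hle : LinearMap.ker (edgeBoundary F) ≤
        Submodule.span (ZMod 2) (((P'.erase x₀).image b : Finset (F → ZMod 2)) : Set _) := by
      intro z hz
      obtain ⟨y, hy⟩ := hspan z hz
      have : z = ∑ x ∈ P'.erase x₀, (y x + y x₀) • b x := by
        ext f
        have h1 := hsum y f
        have h2 := hsum (fun _ => y x₀) f
        rw [CharTwo.add_self_eq_zero] at h2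
        rw [← hy f] at h1
        rw [← Finset.add_sum_erase _ _ hx₀] at h1 h2
        simp only [Finset.sum_apply, Pi.smul_apply, smul_eq_mul, add_mul, Finset.sum_add_distrib]
        rw [← h1]
        have key : ∀ a c d : ZMod 2, a + d = 0 → a + c = c + d := by decide
        exact key _ _ _ h2
      rw [this]
      exact Submodule.sum_mem _ fun x hx => Submodule.smul_mem _ _
        (Submodule.subset_span (by exact_mod_cast Finset.mem_image_of_mem b hx))
    have h1 := (Submodule.finrank_mono hle).trans
      ((finrank_span_finset_le_card _).trans Finset.card_image_le)
    rw [Finset.card_erase_of_mem hx₀] at h1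
    have : 0 < P'.card := Finset.card_pos.2 ⟨_, hx₀⟩
    omega

end EdgeSpace

/-- Euler's inequality for minors of the square grid: a simple
bipartite graph with edge set `F`, modelled in the grid by disjoint connected vertex sets `B w`,
has at most `2 |W| - 4` edges. -/
theorem card_add_four_le_of_grid_model {W : Type*} [Fintype W]
    (F : Finset (W × W)) (col : W → Bool)
    (hcol : ∀ f ∈ F, col f.1 = false ∧ col f.2 = true) (hW : 3 ≤ Fintype.card W)
    (B : W → Finset (ℤ × ℤ)) (hne : ∀ w, (B w).Nonempty)
    (hdisj : ∀ v w, v ≠ w → Disjoint (B v) (B w))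
    (hconn : ∀ w, GridConn (B w : Set (ℤ × ℤ)))
    (hadj : ∀ f ∈ F, ∃ z ∈ B f.1, ∃ w ∈ B f.2, GridAdj z w) :
    F.card + 4 ≤ 2 * Fintype.card W := by
  classical
  have huniq : ∀ {u v w}, u ∈ B v → u ∈ B w → v = w := by
    intro u v w hv hw
    by_contra h
    exact Finset.disjoint_left.1 (hdisj v w h) hv hw
  have hedge : ∀ f : F, ∃ e : Bool × (ℤ × ℤ),
      (e.2 ∈ B f.1.1 ∧ e.2 + gridDir e.1 ∈ B f.1.2) ∨
      (e.2 ∈ B f.1.2 ∧ e.2 + gridDir e.1 ∈ B f.1.1) := by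
    intro f
    obtain ⟨z, hz, w, hw, b, h | h⟩ := hadj _ f.2
    · exact ⟨(b, z), Or.inl ⟨hz, h ▸ hw⟩⟩
    · exact ⟨(b, w), Or.inr ⟨hw, h ▸ hz⟩⟩
  choose g hg using hedge
  have hfne : ∀ f k : F, f.1.1 ≠ k.1.2 := by
    intro f k h
    have h1 := (hcol _ f.2).1
    rw [h, (hcol _ k.2).2] at h1
    simp at h1
  have ginj : Function.Injective g := by
    intro f k h
    have h1 := hg f
    rw [h] at h1
    rcases h1 with ⟨h1, h2⟩ | ⟨h1, h2⟩ <;> rcases hg k with ⟨h3, h4⟩ | ⟨h3, h4⟩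
    · exact Subtype.ext (Prod.ext (huniq h1 h3) (huniq h2 h4))
    · exact absurd (huniq h1 h3) (hfne f k)
    · exact absurd (huniq h3 h1) (hfne k f)
    · exact Subtype.ext (Prod.ext (huniq h2 h4) (huniq h1 h3))
  have gcross : ∀ f w, ¬((g f).2 ∈ B w ∧ (g f).2 + gridDir (g f).1 ∈ B w) := by
    rintro f w ⟨h1, h2⟩
    rcases hg f with ⟨h3, h4⟩ | ⟨h3, h4⟩
    · exact hfne f f ((huniq h3 h1).trans (huniq h2 h4))
    · exact hfne f f ((huniq h4 h2).trans (huniq h1 h3))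
  let H : Set (Bool × (ℤ × ℤ)) :=
    {e | (∃ w, e.2 ∈ B w ∧ e.2 + gridDir e.1 ∈ B w) ∨ ∃ f, e = g f}
  let s : Setoid (ℤ × ℤ) := Relation.EqvGen.setoid fun a c => ∃ e, e ∉ H ∧ a = e.2 ∧
    c = e.2 - gridDir !e.1
  let q : ℤ × ℤ → Quotient s := Quotient.mk s
  have hq : ∀ e, e ∉ H → q e.2 = q (e.2 - gridDir !e.1) := fun e he =>
    Quotient.sound (Relation.EqvGen.rel _ _ ⟨e, he, rfl, rfl⟩)
  refine card_add_four_le_of_faces F col hcol hW (fun f => q (g f).2)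
    (fun f => q ((g f).2 - gridDir !(g f).1)) ?_ ?_
  · intro x
    ext w
    rw [edgeBoundary_apply, Pi.zero_apply]
    let ι : ℤ × ℤ → ZMod 2 := fun z => if q z = x then 1 else 0
    let κ : Bool × (ℤ × ℤ) → ZMod 2 := fun e => ι e.2 + ι (e.2 - gridDir !e.1)
    have hκ : ∀ e, e ∉ H → κ e = 0 := by
      intro e he
      simp only [κ, ι]
      rw [hq e he, CharTwo.add_self_eq_zero]
    have hround : ∀ u, ∑ b, (κ (b, u) + κ (b, u - gridDir b)) = 0 := by
      intro u
      simp only [Fintype.sum_bool, κ, Bool.not_true, Bool.not_false]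
      rw [sub_right_comm u (gridDir true)]
      generalize ι u = a1
      generalize ι (u - gridDir false) = a2
      generalize ι (u - gridDir true) = a3
      generalize ι (u - gridDir false - gridDir true) = a4
      revert a1 a2 a3 a4; decide
    let E1 : Finset (Bool × (ℤ × ℤ)) := Finset.univ ×ˢ B w
    let E2 : Finset (Bool × (ℤ × ℤ)) := E1.image fun e => (e.1, e.2 - gridDir e.1)
    have hE1 : ∀ e, e ∈ E1 ↔ e.2 ∈ B w := by intro e; simp [E1]
    have hE2 : ∀ e, e ∈ E2 ↔ e.2 + gridDir e.1 ∈ B w := by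
      intro e
      simp only [E2, Finset.mem_image, hE1]
      constructor
      · rintro ⟨a, ha, rfl⟩; simpa using ha
      · intro h; exact ⟨(e.1, e.2 + gridDir e.1), h, by simp⟩
    let G : Bool × (ℤ × ℤ) → ZMod 2 := fun e =>
      ((if e ∈ E1 then 1 else 0) + (if e ∈ E2 then 1 else 0)) * κ e
    have hG0 : ∑ e ∈ E1 ∪ E2, G e = 0 := by
      have h1 : ∑ e ∈ E1 ∪ E2, G e = ∑ e ∈ E1, κ e + ∑ e ∈ E2, κ e := by
        simp only [G, add_mul, Finset.sum_add_distrib, ite_mul, one_mul, zero_mul]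
        rw [← Finset.sum_filter, ← Finset.sum_filter]
        congr 2 <;> ext e <;> simp
      have h2 : ∑ e ∈ E2, κ e = ∑ e ∈ E1, κ (e.1, e.2 - gridDir e.1) := by
        refine Finset.sum_image ?_
        intro a _ c _ h
        simp only [Prod.mk.injEq] at h
        refine Prod.ext h.1 ?_
        have := h.2
        rw [h.1] at this
        exact sub_left_injective this
      rw [h1, h2, ← Finset.sum_add_distrib]
      simp only [E1]
      rw [Finset.sum_product_right]
      exact Finset.sum_eq_zero fun u _ => hround u
    have hGimg : ∑ f : F, G (g f) = ∑ e ∈ E1 ∪ E2, G e := by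
      rw [← Finset.sum_image (s := Finset.univ) (g := g) (f := G) (fun a _ c _ h => ginj h)]
      have hz : ∀ e, ¬(e ∈ Finset.univ.image g ∧ e ∈ E1 ∪ E2) → G e = 0 := by
        intro e he
        by_cases h1 : e ∈ E1 <;> by_cases h2 : e ∈ E2
        · simp [G, h1, h2, CharTwo.add_self_eq_zero]
        · have : e ∉ H := by
            rintro (⟨v, hv1, hv2⟩ | ⟨f, rfl⟩)
            · rw [← huniq ((hE1 e).1 h1) hv1] at hv2
              exact h2 ((hE2 e).2 hv2)
            · exact he ⟨Finset.mem_image_of_mem _ (by simp), Finset.mem_union_left _ h1⟩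
          simp only [G, hκ e this, mul_zero]
        · have : e ∉ H := by
            rintro (⟨v, hv1, hv2⟩ | ⟨f, rfl⟩)
            · rw [← huniq ((hE2 e).1 h2) hv2] at hv1
              exact h1 ((hE1 e).2 hv1)
            · exact he ⟨Finset.mem_image_of_mem _ (by simp), Finset.mem_union_right _ h2⟩
          simp only [G, hκ e this, mul_zero]
        · simp [G, h1, h2]
      have hl := Finset.sum_subset (f := G)
        (Finset.inter_subset_left (s₁ := Finset.univ.image g) (s₂ := E1 ∪ E2))
        fun e _ h => hz e fun h' => h (Finset.mem_inter.2 h')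
      have hr := Finset.sum_subset (f := G)
        (Finset.inter_subset_right (s₁ := Finset.univ.image g) (s₂ := E1 ∪ E2))
        fun e _ h => hz e fun h' => h (Finset.mem_inter.2 h')
      exact hl.symm.trans hr
    refine Eq.trans ?_ (hGimg.trans hG0)
    refine Finset.sum_congr rfl fun f _ => ?_
    have : ((if f.1.1 = w then 1 else 0) + (if f.1.2 = w then 1 else 0) : ZMod 2) =
        (if g f ∈ E1 then 1 else 0) + (if g f ∈ E2 then 1 else 0) := by
      simp only [hE1, hE2]
      have hiff : ∀ {u v}, u ∈ B v → (u ∈ B w ↔ v = w) := fun hu =>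
        ⟨fun h => huniq hu h, fun h => h ▸ hu⟩
      rcases hg f with ⟨h3, h4⟩ | ⟨h3, h4⟩
      · simp only [hiff h3, hiff h4]
      · simp only [hiff h3, hiff h4]; rw [add_comm]
    rw [this]
  · intro z hz
    choose r hr using hne
    have hp : ∀ u w, ∃ c : Bool × (ℤ × ℤ) → ZMod 2, u ∈ B w →
        (∀ e, c e ≠ 0 → e.2 ∈ B w ∧ e.2 + gridDir e.1 ∈ B w) ∧
        ∀ x, gridBoundary c x = (if x = u then 1 else 0) + (if x = r w then 1 else 0) := by
      intro u w
      by_cases hu : u ∈ B w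
      · obtain ⟨c, h1, h2⟩ := (hconn w u hu (r w) (hr w)).exists_chain
        exact ⟨c, fun _ => ⟨h1, h2⟩⟩
      · exact ⟨0, fun h => absurd h hu⟩
    choose p hp using hp
    have hlift : ∀ f : F, ∃ c : Bool × (ℤ × ℤ) → ZMod 2,
        (∀ e, c e ≠ 0 → e = g f ∨ ∃ w, e.2 ∈ B w ∧ e.2 + gridDir e.1 ∈ B w) ∧
        c (g f) = 1 ∧
        ∀ x, gridBoundary c x =
          (if x = r f.1.1 then 1 else 0) + (if x = r f.1.2 then 1 else 0) := by
      intro f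
      obtain ⟨w1, w2, hw, h1, h2⟩ : ∃ w1 w2, ((w1 = f.1.1 ∧ w2 = f.1.2) ∨
          (w1 = f.1.2 ∧ w2 = f.1.1)) ∧ (g f).2 ∈ B w1 ∧ (g f).2 + gridDir (g f).1 ∈ B w2 := by
        rcases hg f with h | h
        · exact ⟨_, _, Or.inl ⟨rfl, rfl⟩, h⟩
        · exact ⟨_, _, Or.inr ⟨rfl, rfl⟩, h⟩
      obtain ⟨p1, b1⟩ := hp _ _ h1
      obtain ⟨p2, b2⟩ := hp _ _ h2
      refine ⟨(fun x => if x = g f then 1 else 0) + p (g f).2 w1 +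
        p ((g f).2 + gridDir (g f).1) w2, ?_, ?_, ?_⟩
      · intro e he
        by_contra! hcon
        have z1 : p (g f).2 w1 e = 0 := by
          by_contra h; exact hcon.2 _ (p1 e h).1 (p1 e h).2
        have z2 : p ((g f).2 + gridDir (g f).1) w2 e = 0 := by
          by_contra h; exact hcon.2 _ (p2 e h).1 (p2 e h).2
        simp [hcon.1, z1, z2] at he
      · have z1 : p (g f).2 w1 (g f) = 0 := by
          by_contra h; exact gcross f _ (p1 _ h)
        have z2 : p ((g f).2 + gridDir (g f).1) w2 (g f) = 0 := by
          by_contra h; exact gcross f _ (p2 _ h)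
        simp [z1, z2]
      · intro x
        rw [gridBoundary_add, gridBoundary_add, gridBoundary_single, b1, b2]
        have key : ∀ a b c d : ZMod 2, a + b + (a + c) + (b + d) = c + d := by decide
        rw [key]
        rcases hw with ⟨rfl, rfl⟩ | ⟨rfl, rfl⟩
        · rfl
        · rw [add_comm]
    choose L hL1 hL2 hL3 using hlift
    let c : Bool × (ℤ × ℤ) → ZMod 2 := fun e => ∑ f : F, z f * L f e
    have hcH : ∀ e, e ∉ H → c e = 0 := by
      intro e he
      refine Finset.sum_eq_zero fun f _ => ?_
      have : L f e = 0 := by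
        by_contra h
        rcases hL1 f e h with rfl | h
        · exact he (Or.inr ⟨f, rfl⟩)
        · exact he (Or.inl h)
      rw [this, mul_zero]
    have hcg : ∀ f, c (g f) = z f := by
      intro f
      simp only [c]
      rw [Finset.sum_eq_single f]
      · rw [hL2, mul_one]
      · intro k _ hk
        have : L k (g f) = 0 := by
          by_contra h
          rcases hL1 k _ h with h | ⟨w, h⟩
          · exact hk (ginj h).symm
          · exact gcross f w h
        rw [this, mul_zero]
      · simp
    have hcb : ∀ u, gridBoundary c u = 0 := by
      intro u
      have h1 := gridBoundary_sum Finset.univ z L u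
      simp only [hL3] at h1
      have hru : ∀ w, r w = u ↔ u = r w := fun w => eq_comm
      have h2 : gridBoundary c u = ∑ w, edgeBoundary F z w * (if u = r w then 1 else 0) := by
        refine h1.trans ?_
        simp only [edgeBoundary_apply, Finset.sum_mul]
        rw [Finset.sum_comm]
        refine Finset.sum_congr rfl fun f _ => ?_
        simp only [add_mul, Finset.sum_add_distrib, ite_mul, one_mul, zero_mul]
        rw [Finset.sum_ite_eq, Finset.sum_ite_eq]
        simp only [Finset.mem_univ, if_true]
        ring
      rw [h2, hz]
      simp
    obtain ⟨M, hM⟩ : ∃ M : ℤ, ∀ w, ∀ u ∈ B w, M < u.2 := by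
      obtain ⟨M, hM⟩ := ((Finset.univ.biUnion B).image Prod.snd).bddBelow
      refine ⟨M - 1, fun w u hu => ?_⟩
      have : M ≤ u.2 := hM (by
        simp only [Finset.coe_image, Set.mem_image, Finset.mem_coe, Finset.mem_biUnion]
        exact ⟨u, ⟨w, by simp, hu⟩, rfl⟩)
      omega
    have hlow : ∀ b z, z.2 ≤ M → c (b, z) = 0 := by
      intro b y hy
      refine hcH _ ?_
      rintro (⟨w, h, _⟩ | ⟨f, h⟩)
      · exact absurd (hM w _ h) (not_lt.2 hy)
      · have h2 : y = (g f).2 := congrArg Prod.snd h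
        rcases hg f with ⟨h3, _⟩ | ⟨h3, _⟩ <;>
        · rw [← h2] at h3
          exact absurd (hM _ _ h3) (not_lt.2 hy)
    obtain ⟨φ, hφ⟩ := exists_cell_potential c M hlow hcb
    have hφq : ∀ a d, s a d → φ a = φ d := by
      intro a d h
      induction h with
      | rel a d h =>
        obtain ⟨e, he, rfl, rfl⟩ := h
        have := hφ e.1 e.2
        rw [hcH _ he] at this
        exact CharTwo.add_eq_zero.1 this.symm
      | refl => rfl
      | symm _ _ _ ih => exact ih.symm
      | trans _ _ _ _ _ ih1 ih2 => exact ih1.trans ih2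
    refine ⟨Quotient.lift φ hφq, fun f => ?_⟩
    rw [← hcg f, hφ (g f).1 (g f).2]
    rfl

section Approximation

open Filter Topology

/-- The point of the plane represented by a grid point at mesh `δ`. -/
def gridPt (δ : ℝ) (z : ℤ × ℤ) : ℝ × ℝ := (δ * z.1, δ * z.2)

/-- The grid points at distance less than `δ` from the set `X`, at mesh `δ`. -/
def gridBlob (δ : ℝ) (X : Set (ℝ × ℝ)) : Set (ℤ × ℤ) := {z | ∃ x ∈ X, dist (gridPt δ z) x < δ}

lemma exists_gridPt_dist_lt {δ : ℝ} (hδ : 0 < δ) (x : ℝ × ℝ) : ∃ z, dist (gridPt δ z) x < δ := by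
  have key : ∀ a : ℝ, |δ * ⌊a / δ⌋ - a| < δ := by
    intro a
    have h1 := Int.floor_le (a / δ)
    have h2 := Int.lt_floor_add_one (a / δ)
    rw [le_div_iff₀ hδ] at h1
    rw [div_lt_iff₀ hδ] at h2
    rw [abs_lt]; constructor <;> nlinarith
  refine ⟨(⌊x.1 / δ⌋, ⌊x.2 / δ⌋), ?_⟩
  rw [Prod.dist_eq, max_lt_iff, Real.dist_eq, Real.dist_eq]
  exact ⟨key _, key _⟩

/-- The grid points close to a given point form a connected set. -/
lemma gridReach_of_dist_lt {δ : ℝ} (hδ : 0 < δ) {S : Set (ℤ × ℤ)} {x : ℝ × ℝ}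
    (hS : ∀ z, dist (gridPt δ z) x < δ → z ∈ S) {z w : ℤ × ℤ}
    (hz : dist (gridPt δ z) x < δ) (hw : dist (gridPt δ w) x < δ) : GridReach S z w := by
  obtain ⟨a, b⟩ := z
  obtain ⟨c, d⟩ := w
  simp only [gridPt, Prod.dist_eq, max_lt_iff, Real.dist_eq] at hz hw hS
  have hcb : (c, b) ∈ S := hS (c, b) ⟨hw.1, hz.2⟩
  have near : ∀ {i j : ℤ} {t : ℝ}, |δ * i - t| < δ → |δ * j - t| < δ →
      i = j ∨ j = i + 1 ∨ i = j + 1 := by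
    intro i j t hi hj
    rw [abs_lt] at hi hj
    have h1 : δ * (i - j) < δ * 2 := by linarith
    have h2 : δ * (j - i) < δ * 2 := by linarith
    have h1' := lt_of_mul_lt_mul_left h1 hδ.le
    have h2' := lt_of_mul_lt_mul_left h2 hδ.le
    have h3 : i - j < 2 := by exact_mod_cast h1'
    have h4 : j - i < 2 := by exact_mod_cast h2'
    omega
  have step1 : GridReach S (a, b) (c, b) := by
    rcases near hz.1 hw.1 with rfl | h | h
    · exact Relation.ReflTransGen.refl
    · exact Relation.ReflTransGen.single ⟨⟨true, Or.inl (by simp [gridDir, h])⟩, hS _ hz, hcb⟩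
    · exact Relation.ReflTransGen.single ⟨⟨true, Or.inr (by simp [gridDir, h])⟩, hS _ hz, hcb⟩
  have step2 : GridReach S (c, b) (c, d) := by
    rcases near hz.2 hw.2 with rfl | h | h
    · exact Relation.ReflTransGen.refl
    · exact Relation.ReflTransGen.single ⟨⟨false, Or.inl (by simp [gridDir, h])⟩, hcb, hS _ hw⟩
    · exact Relation.ReflTransGen.single ⟨⟨false, Or.inr (by simp [gridDir, h])⟩, hcb, hS _ hw⟩
  exact step1.trans step2

/-- The grid neighbourhood of a connected set is connected. -/
lemma gridConn_gridBlob {δ : ℝ} (hδ : 0 < δ) {X : Set (ℝ × ℝ)} (hX : IsPreconnected X) :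
    GridConn (gridBlob δ X) := by
  let P : ℝ × ℝ → ℝ × ℝ → Prop := fun x y => ∀ z w, dist (gridPt δ z) x < δ →
    dist (gridPt δ w) y < δ → GridReach (gridBlob δ X) z w
  have hP : ∀ x ∈ X, ∀ y ∈ X, P x y := by
    intro x hx y hy
    refine hX.induction₂' P ?_ ?_ hx hy
    · intro a ha
      obtain ⟨z₀, hz₀⟩ := exists_gridPt_dist_lt hδ a
      have hnear : ∀ᶠ y in 𝓝[X] a, dist (gridPt δ z₀) y < δ := by
        refine eventually_nhdsWithin_of_eventually_nhds ?_
        exact (continuous_const.dist continuous_id).continuousAt.eventually_lt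
          continuousAt_const hz₀
      filter_upwards [hnear, self_mem_nhdsWithin] with y hy hyX
      have h1 : P a y := by
        intro z w hz hw
        exact (gridReach_of_dist_lt hδ (S := gridBlob δ X) (fun _ h => ⟨a, ha, h⟩) hz hz₀).trans
          (gridReach_of_dist_lt hδ (S := gridBlob δ X) (fun _ h => ⟨y, hyX, h⟩) hy hw)
      exact ⟨h1, fun z w hz hw => (h1 w z hw hz).symm⟩
    · intro a b c _ _ _ hab hbc z w hz hw
      obtain ⟨z₀, hz₀⟩ := exists_gridPt_dist_lt hδ b
      exact (hab z z₀ hz hz₀).trans (hbc z₀ w hz₀ hw)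
  rintro z ⟨x, hx, hzx⟩ w ⟨y, hy, hwy⟩
  exact hP x hx y hy z w hzx hwy

lemma finite_gridBlob {δ : ℝ} (hδ : 0 < δ) {X : Set (ℝ × ℝ)} (hX : IsCompact X) :
    (gridBlob δ X).Finite := by
  obtain ⟨R, hR⟩ := hX.isBounded.subset_closedBall (0 : ℝ × ℝ)
  obtain ⟨n, hn⟩ := exists_nat_gt ((R + δ) / δ)
  refine (Set.finite_Icc ((-n, -n) : ℤ × ℤ) (n, n)).subset ?_
  rintro z ⟨x, hx, hzx⟩
  have h1 : dist (gridPt δ z) 0 < R + δ := by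
    have h := dist_triangle (gridPt δ z) x 0
    have h' : dist x 0 ≤ R := hR hx
    linarith
  rw [div_lt_iff₀ hδ] at hn
  have h2 : dist (gridPt δ z) 0 < n * δ := h1.trans hn
  simp only [gridPt, Prod.dist_eq, max_lt_iff, Real.dist_eq, Prod.fst_zero, Prod.snd_zero,
    sub_zero, abs_lt] at h2
  obtain ⟨⟨a1, a2⟩, a3, a4⟩ := h2
  have key : ∀ i : ℤ, -(n * δ) < δ * i → δ * i < n * δ → -(n : ℤ) ≤ i ∧ i ≤ n := by
    intro i b1 b2
    have c1 : δ * (-n : ℝ) < δ * i := by linarith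
    have c2 : δ * (i : ℝ) < δ * n := by linarith
    have d1 := lt_of_mul_lt_mul_left c1 hδ.le
    have d2 := lt_of_mul_lt_mul_left c2 hδ.le
    constructor
    · have : (-(n : ℤ)) < i := by exact_mod_cast d1
      exact this.le
    · have : i < (n : ℤ) := by exact_mod_cast d2
      exact this.le
  have k1 := key _ a1 a2
  have k2 := key _ a3 a4
  exact ⟨⟨k1.1, k2.1⟩, ⟨k1.2, k2.2⟩⟩

/-- A path in `S` leaving the set `P` does so along some edge. -/
lemma GridReach.exists_exit {S P : Set (ℤ × ℤ)} {z w : ℤ × ℤ} (h : GridReach S z w)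
    (hz : z ∈ P) (hw : w ∉ P) : ∃ a ∈ P, ∃ b, b ∉ P ∧ b ∈ S ∧ GridAdj a b := by
  induction h with
  | refl => exact absurd hz hw
  | @tail x y _ h ih =>
    by_cases hx : x ∈ P
    · exact ⟨x, hx, y, hw, h.2.2, h.1⟩
    · exact ih hx

lemma gridConn_setOf_gridReach (S : Set (ℤ × ℤ)) (z : ℤ × ℤ) :
    GridConn {w | GridReach S z w} := by
  have key : ∀ w, GridReach S z w → GridReach {w | GridReach S z w} z w := by
    intro w h
    induction h with
    | refl => exact Relation.ReflTransGen.refl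
    | tail h1 h2 ih => exact ih.tail ⟨h2.1, h1, h1.tail h2⟩
  exact fun a ha b hb => (key a ha).symm.trans (key b hb)

lemma IsCompact.eventually_mul_le_dist {C : Set (ℝ × ℝ)} (hC : IsCompact C) {p : ℝ × ℝ}
    (hp : p ∉ C) : ∀ᶠ r : ℝ in 𝓝[>] 0, ∀ x ∈ C, 4 * r ≤ dist x p := by
  obtain ⟨ε, hε, h⟩ := Metric.mem_nhds_iff.1 (hC.isClosed.isOpen_compl.mem_nhds hp)
  filter_upwards [Ioo_mem_nhdsGT (show (0 : ℝ) < ε / 4 by positivity)] with r hr x hx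
  by_contra! hlt
  exact h (show x ∈ Metric.ball p ε from by
    rw [Metric.mem_ball]; linarith [hr.2]) hx

lemma eventually_two_mul_le_dist {C D : Set (ℝ × ℝ)} (hC : IsCompact C) (hD : IsCompact D)
    (h : Disjoint C D) : ∀ᶠ δ : ℝ in 𝓝[>] 0, ∀ x ∈ C, ∀ y ∈ D, 2 * δ ≤ dist x y := by
  obtain ⟨ε, hε, h⟩ := h.exists_thickenings hC hD.isClosed
  filter_upwards [Ioo_mem_nhdsGT (show (0 : ℝ) < ε / 2 by positivity)] with r hr x hx y hy
  by_contra! hlt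
  refine Set.disjoint_left.1 h (Metric.mem_thickening_iff.2 ⟨x, hx, ?_⟩)
    (Metric.self_subset_thickening hε D hy)
  rw [_root_.dist_comm]; linarith [hr.2]

/-- Finitely many arcs between points of the plane, grouped into connected families with
pairwise disjoint interiors, are modelled by connected sets of grid points. -/
theorem exists_grid_model {V ι ε : Type*} [Finite V] [Finite ε]
    (p : V → ℝ × ℝ) (hp : Function.Injective p) (src tgt : ε → V) (cl : ε → ι)
    (hcl : Function.Surjective cl) (γ : ε → ℝ → ℝ × ℝ) (hγ : ∀ e, Continuous (γ e))
    (hγ0 : ∀ e, γ e 0 = p (src e)) (hγ1 : ∀ e, γ e 1 = p (tgt e))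
    (havoid : ∀ e, ∀ t ∈ Set.Ioo (0 : ℝ) 1, ∀ w, γ e t ≠ p w)
    (hconn : ∀ e f, cl e = cl f → Relation.ReflTransGen (fun a b => cl a = cl b ∧
      ∃ s ∈ Set.Ioo (0 : ℝ) 1, ∃ t ∈ Set.Ioo (0 : ℝ) 1, γ a s = γ b t) e f)
    (hdisj : ∀ e f, cl e ≠ cl f → ∀ s ∈ Set.Ioo (0 : ℝ) 1, ∀ t ∈ Set.Ioo (0 : ℝ) 1,
      γ e s ≠ γ f t) :
    ∃ B : V ⊕ ι → Finset (ℤ × ℤ), (∀ x, (B x).Nonempty) ∧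
      (∀ x y, x ≠ y → Disjoint (B x) (B y)) ∧ (∀ x, GridConn (B x : Set (ℤ × ℤ))) ∧
      ∀ e, ∀ v, v = src e ∨ v = tgt e →
        ∃ z ∈ B (Sum.inl v), ∃ w ∈ B (Sum.inr (cl e)), GridAdj z w := by
  classical
  -- the trimmed arcs
  obtain ⟨η, ⟨hη0, hη1⟩, hη⟩ : ∃ η : ℝ, (0 < η ∧ η < 1 / 2) ∧ ∀ a b,
      (∃ s ∈ Set.Ioo (0 : ℝ) 1, ∃ t ∈ Set.Ioo (0 : ℝ) 1, γ a s = γ b t) →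
      ∃ s ∈ Set.Icc η (1 - η), ∃ t ∈ Set.Icc η (1 - η), γ a s = γ b t := by
    have h1 : ∀ᶠ η : ℝ in 𝓝[>] 0, ∀ a b,
      (∃ s ∈ Set.Ioo (0 : ℝ) 1, ∃ t ∈ Set.Ioo (0 : ℝ) 1, γ a s = γ b t) →
      ∃ s ∈ Set.Icc η (1 - η), ∃ t ∈ Set.Icc η (1 - η), γ a s = γ b t := by
      refine eventually_all.2 fun a => eventually_all.2 fun b => ?_
      by_cases h : ∃ s ∈ Set.Ioo (0 : ℝ) 1, ∃ t ∈ Set.Ioo (0 : ℝ) 1, γ a s = γ b t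
      · obtain ⟨s, hs, t, ht, hst⟩ := h
        filter_upwards [Ioo_mem_nhdsGT hs.1, Ioo_mem_nhdsGT ht.1,
          Ioo_mem_nhdsGT (sub_pos.2 hs.2), Ioo_mem_nhdsGT (sub_pos.2 ht.2)] with η h1 h2 h3 h4 _
        exact ⟨s, ⟨h1.2.le, by linarith [h3.2]⟩, t, ⟨h2.2.le, by linarith [h4.2]⟩, hst⟩
      · exact Eventually.of_forall fun _ h' => absurd h' h
    obtain ⟨η, h, h'⟩ := (h1.and (Ioo_mem_nhdsGT (show (0 : ℝ) < 1 / 2 by norm_num))).exists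
    exact ⟨η, h', h⟩
  have hsub : Set.Icc η (1 - η) ⊆ Set.Ioo 0 1 := fun t ht =>
    ⟨hη0.trans_le ht.1, by linarith [ht.2]⟩
  let core : ι → Set (ℝ × ℝ) := fun i => ⋃ e ∈ {e | cl e = i}, γ e '' Set.Icc η (1 - η)
  have hcore : ∀ i, IsPreconnected (core i) := by
    intro i
    refine IsPreconnected.biUnion_of_reflTransGen
      (fun e _ => isPreconnected_Icc.image _ (hγ e).continuousOn) ?_
    intro e he f hf
    have h := hconn e f (he.trans hf.symm)
    have : ∀ g, Relation.ReflTransGen (fun a b => cl a = cl b ∧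
        ∃ s ∈ Set.Ioo (0 : ℝ) 1, ∃ t ∈ Set.Ioo (0 : ℝ) 1, γ a s = γ b t) e g → cl g = i ∧
        Relation.ReflTransGen (fun a b => (γ a '' Set.Icc η (1 - η) ∩
          γ b '' Set.Icc η (1 - η)).Nonempty ∧ a ∈ {e | cl e = i}) e g := by
      intro g hg
      induction hg with
      | refl => exact ⟨he, Relation.ReflTransGen.refl⟩
      | tail _ h ih =>
        refine ⟨h.1.symm.trans ih.1, ih.2.tail ⟨?_, ih.1⟩⟩
        obtain ⟨s, hs, t, ht, heq⟩ := hη _ _ h.2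
        exact ⟨_, ⟨s, hs, rfl⟩, t, ht, heq.symm⟩
    exact (this f h).2
  have hcompact : ∀ e (a b : ℝ), IsCompact (γ e '' Set.Icc a b) := fun e a b =>
    isCompact_Icc.image (hγ e)
  -- the radius of the discs around the vertices
  obtain ⟨r, hr0, hr1, hr2, hr3, hr4⟩ : ∃ r : ℝ, 0 < r ∧
      (∀ v w, v ≠ w → 4 * r ≤ dist (p v) (p w)) ∧
      (∀ e v, ∀ x ∈ γ e '' Set.Icc η (1 - η), 4 * r ≤ dist x (p v)) ∧
      (∀ e v, v ≠ src e → ∀ x ∈ γ e '' Set.Icc 0 (1 / 2), 4 * r ≤ dist x (p v)) ∧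
      (∀ e v, v ≠ tgt e → ∀ x ∈ γ e '' Set.Icc (1 / 2) 1, 4 * r ≤ dist x (p v)) := by
    have h1 : ∀ᶠ r : ℝ in 𝓝[>] 0, ∀ v w, v ≠ w → 4 * r ≤ dist (p v) (p w) := by
      refine eventually_all.2 fun v => eventually_all.2 fun w => ?_
      by_cases h : v = w
      · exact Eventually.of_forall fun _ h' => absurd h h'
      · filter_upwards [isCompact_singleton.eventually_mul_le_dist
          (C := {p v}) (p := p w) fun h' => h (hp h').symm] with r hr _
        exact hr _ rfl
    have h2 : ∀ᶠ r : ℝ in 𝓝[>] 0, ∀ e v, ∀ x ∈ γ e '' Set.Icc η (1 - η),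
        4 * r ≤ dist x (p v) := by
      refine eventually_all.2 fun e => eventually_all.2 fun v => ?_
      refine (hcompact e _ _).eventually_mul_le_dist ?_
      rintro ⟨t, ht, h⟩
      exact havoid e t (hsub ht) v h
    have h3 : ∀ᶠ r : ℝ in 𝓝[>] 0, ∀ e v, v ≠ src e → ∀ x ∈ γ e '' Set.Icc 0 (1 / 2),
        4 * r ≤ dist x (p v) := by
      refine eventually_all.2 fun e => eventually_all.2 fun v => ?_
      by_cases hv : v = src e
      · exact Eventually.of_forall fun _ h' => absurd hv h'
      refine ((hcompact e 0 (1 / 2)).eventually_mul_le_dist (p := p v) ?_).mono fun r hr _ => hr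
      rintro ⟨t, ht, h⟩
      rcases ht.1.eq_or_lt with rfl | h0
      · exact hv (hp (h.symm.trans (hγ0 e)))
      · exact havoid e t ⟨h0, by linarith [ht.2]⟩ v h
    have h4 : ∀ᶠ r : ℝ in 𝓝[>] 0, ∀ e v, v ≠ tgt e → ∀ x ∈ γ e '' Set.Icc (1 / 2) 1,
        4 * r ≤ dist x (p v) := by
      refine eventually_all.2 fun e => eventually_all.2 fun v => ?_
      by_cases hv : v = tgt e
      · exact Eventually.of_forall fun _ h' => absurd hv h'
      refine ((hcompact e (1 / 2) 1).eventually_mul_le_dist (p := p v) ?_).mono fun r hr _ => hr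
      rintro ⟨t, ht, h⟩
      rcases ht.2.eq_or_lt with rfl | h0
      · exact hv (hp (h.symm.trans (hγ1 e)))
      · exact havoid e t ⟨by linarith [ht.1], h0⟩ v h
    obtain ⟨r, h⟩ := (h1.and (h2.and (h3.and (h4.and self_mem_nhdsWithin)))).exists
    exact ⟨r, h.2.2.2.2, h.1, h.2.1, h.2.2.1, h.2.2.2.1⟩
  let C : ε → Set (ℝ × ℝ) := fun e => γ e '' Set.Icc 0 1 ∩ {x | ∀ v, r ≤ dist x (p v)}
  have hC : ∀ e, IsCompact (C e) := by
    intro e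
    refine (hcompact e 0 1).inter_right ?_
    simp only [Set.ofPred_forall]
    exact isClosed_iInter fun v =>
      isClosed_le continuous_const (continuous_id.dist continuous_const)
  have hCmem : ∀ e x, x ∈ C e → ∃ t ∈ Set.Ioo (0 : ℝ) 1, γ e t = x := by
    rintro e _ ⟨⟨t, ht, rfl⟩, hx⟩
    refine ⟨t, ⟨ht.1.lt_of_ne ?_, ht.2.lt_of_ne ?_⟩, rfl⟩
    · rintro rfl
      have := hx (src e)
      rw [hγ0, _root_.dist_self] at this
      exact this.not_gt hr0
    · rintro rfl
      have := hx (tgt e)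
      rw [hγ1, _root_.dist_self] at this
      exact this.not_gt hr0
  obtain ⟨δ, hδ0, hδr, hδ⟩ : ∃ δ : ℝ, 0 < δ ∧ δ < r / 2 ∧
      ∀ e f, cl e ≠ cl f → ∀ x ∈ C e, ∀ y ∈ C f, 2 * δ ≤ dist x y := by
    have h1 : ∀ᶠ δ : ℝ in 𝓝[>] 0, ∀ e f, cl e ≠ cl f → ∀ x ∈ C e, ∀ y ∈ C f,
        2 * δ ≤ dist x y := by
      refine eventually_all.2 fun e => eventually_all.2 fun f => ?_
      by_cases h : cl e = cl f
      · exact Eventually.of_forall fun _ h' => absurd h h'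
      refine (eventually_two_mul_le_dist (hC e) (hC f) ?_).mono fun δ h _ => h
      refine Set.disjoint_left.2 fun x hx hy => ?_
      obtain ⟨s, hs, hs'⟩ := hCmem e x hx
      obtain ⟨t, ht, ht'⟩ := hCmem f x hy
      exact hdisj e f h s hs t ht (hs'.trans ht'.symm)
    obtain ⟨δ, h, h'⟩ := (h1.and (Ioo_mem_nhdsGT (show (0 : ℝ) < r / 2 by positivity))).exists
    exact ⟨δ, h'.1, h'.2, h⟩
  -- the grid sets
  let ball : V → Set (ℤ × ℤ) := fun v => gridBlob δ (Metric.closedBall (p v) r)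
  let arcs : ι → Set (ℤ × ℤ) := fun i => gridBlob δ (⋃ e ∈ {e | cl e = i}, γ e '' Set.Icc 0 1)
  let free : ι → Set (ℤ × ℤ) := fun i => arcs i \ ⋃ v, ball v
  have hball : ∀ v z, z ∈ ball v → dist (gridPt δ z) (p v) < r + δ := by
    rintro v z ⟨x, hx, hz⟩
    linarith [dist_triangle (gridPt δ z) x (p v), Metric.mem_closedBall.1 hx]
  have hnear : ∀ v z x, z ∈ ball v → dist (gridPt δ z) x < δ → dist x (p v) < 4 * r := by
    intro v z x hz hx
    linarith [hball v z hz, dist_triangle_left x (p v) (gridPt δ z)]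
  have hball_disj : ∀ v w, v ≠ w → Disjoint (ball v) (ball w) := by
    intro v w hvw
    refine Set.disjoint_left.2 fun z h1 h2 => ?_
    linarith [hball v z h1, hball w z h2, hr1 v w hvw,
      dist_triangle_left (p v) (p w) (gridPt δ z)]
  have hfree : ∀ i z, z ∈ free i → ∃ e, cl e = i ∧ ∃ x ∈ C e, dist (gridPt δ z) x < δ := by
    rintro i z ⟨⟨x, hx, hz⟩, hO⟩
    simp only [Set.mem_iUnion, Set.mem_ofPred_eq, exists_prop] at hx hO
    obtain ⟨e, he, hx⟩ := hx
    refine ⟨e, he, x, ⟨hx, fun v => ?_⟩, hz⟩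
    by_contra! h
    exact hO ⟨v, x, Metric.mem_closedBall.2 h.le, hz⟩
  have hfree_disj : ∀ i j, i ≠ j → Disjoint (free i) (free j) := by
    intro i j hij
    refine Set.disjoint_left.2 fun z h1 h2 => ?_
    obtain ⟨e, he, x, hx, hzx⟩ := hfree i z h1
    obtain ⟨f, hf, y, hy, hzy⟩ := hfree j z h2
    have h := hδ e f (by rw [he, hf]; exact hij) x hx y hy
    linarith [dist_triangle_left x y (gridPt δ z)]
  have hcore_free : ∀ i, gridBlob δ (core i) ⊆ free i := by
    rintro i z ⟨x, hx, hz⟩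
    simp only [core, Set.mem_iUnion, exists_prop] at hx
    obtain ⟨e, he, hx⟩ := hx
    refine ⟨⟨x, ?_, hz⟩, ?_⟩
    · simp only [Set.mem_iUnion, exists_prop]
      exact ⟨e, he, Set.image_mono (hsub.trans Set.Ioo_subset_Icc_self) hx⟩
    · simp only [Set.mem_iUnion, not_exists]
      intro v hv
      linarith [hnear v z x hv hz, hr2 e v x hx]
  have hz : ∀ i, ∃ z, z ∈ gridBlob δ (core i) := by
    intro i
    obtain ⟨e, he⟩ := hcl i
    obtain ⟨z, hz⟩ := exists_gridPt_dist_lt hδ0 (γ e (1 / 2))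
    refine ⟨z, _, ?_, hz⟩
    simp only [core, Set.mem_iUnion, exists_prop]
    exact ⟨e, he, 1 / 2, ⟨by linarith, by linarith⟩, rfl⟩
  choose z₀ hz₀ using hz
  let blob : ι → Set (ℤ × ℤ) := fun i => {z | GridReach (free i) (z₀ i) z}
  have hblob_free : ∀ i, blob i ⊆ free i := by
    intro i z h
    rcases Relation.ReflTransGen.cases_tail h with h | ⟨_, _, h⟩
    · rw [h]; exact hcore_free i (hz₀ i)
    · exact h.2.2
  have hcore_blob : ∀ i, gridBlob δ (core i) ⊆ blob i := fun i z hz =>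
    (gridConn_gridBlob hδ0 (hcore i) _ (hz₀ i) z hz).mono (hcore_free i)
  have hfree_ball : ∀ i v, Disjoint (free i) (ball v) := fun i v =>
    Set.disjoint_left.2 fun z h1 h2 => h1.2 (Set.mem_iUnion.2 ⟨v, h2⟩)
  have hball_fin : ∀ v, (ball v).Finite := fun v =>
    finite_gridBlob hδ0 (isCompact_closedBall _ _)
  have hblob_fin : ∀ i, (blob i).Finite := fun i =>
    (finite_gridBlob hδ0 ((Set.toFinite _).isCompact_biUnion fun e _ =>
      hcompact e 0 1)).subset fun z hz => (hblob_free i hz).1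
  have hadj : ∀ e v, ∀ A ⊆ Set.Icc (0 : ℝ) 1, IsPreconnected A → 1 / 2 ∈ A →
      (∃ t ∈ A, γ e t = p v) → (∀ w, w ≠ v → ∀ x ∈ γ e '' A, 4 * r ≤ dist x (p w)) →
      ∃ z ∈ ball v, ∃ w ∈ blob (cl e), GridAdj z w := by
    rintro e v A hA hAc hA2 ⟨t, htA, ht⟩ hw
    obtain ⟨z₁, hz₁⟩ := exists_gridPt_dist_lt hδ0 (γ e (1 / 2))
    obtain ⟨z₂, hz₂⟩ := exists_gridPt_dist_lt hδ0 (p v)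
    have hreach := gridConn_gridBlob hδ0 (hAc.image _ (hγ e).continuousOn) z₁
      ⟨_, ⟨_, hA2, rfl⟩, hz₁⟩ z₂ ⟨_, ⟨t, htA, rfl⟩, by rw [ht]; exact hz₂⟩
    have h1 : z₁ ∈ blob (cl e) := by
      refine hcore_blob _ ⟨_, ?_, hz₁⟩
      simp only [core, Set.mem_iUnion, exists_prop]
      exact ⟨e, rfl, 1 / 2, ⟨by linarith, by linarith⟩, rfl⟩
    have h2 : z₂ ∉ blob (cl e) := fun h => Set.disjoint_left.1 (hfree_ball (cl e) v)
      (hblob_free _ h) ⟨p v, Metric.mem_closedBall_self hr0.le, hz₂⟩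
    obtain ⟨a, ha, b, hb, hbA, hab⟩ := hreach.exists_exit h1 h2
    obtain ⟨x, hx, hbx⟩ := hbA
    have hbarc : b ∈ arcs (cl e) := by
      refine ⟨x, ?_, hbx⟩
      simp only [Set.mem_iUnion, exists_prop]
      exact ⟨e, rfl, Set.image_mono hA hx⟩
    have hbO : b ∈ ⋃ w, ball w := by
      by_contra h
      exact hb (Relation.ReflTransGen.tail ha ⟨hab, hblob_free _ ha, hbarc, h⟩)
    obtain ⟨w, hbw⟩ := Set.mem_iUnion.1 hbO
    have : w = v := by
      by_contra hwv
      linarith [hw w hwv x hx, hnear w b x hbw hbx]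
    subst this
    exact ⟨b, hbw, a, ha, hab.symm⟩
  refine ⟨Sum.elim (fun v => (hball_fin v).toFinset) (fun i => (hblob_fin i).toFinset),
    ?_, ?_, ?_, ?_⟩
  · rintro (v | i)
    · obtain ⟨z, hz⟩ := exists_gridPt_dist_lt hδ0 (p v)
      exact ⟨z, (hball_fin v).mem_toFinset.2 ⟨p v, Metric.mem_closedBall_self hr0.le, hz⟩⟩
    · exact ⟨z₀ i, by simpa using hcore_blob i (hz₀ i)⟩
  · rintro (v | i) (w | j) h <;> simp only [Sum.elim_inl, Sum.elim_inr] <;>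
      rw [Set.Finite.disjoint_toFinset]
    · exact hball_disj v w fun h' => h (by rw [h'])
    · exact ((hfree_ball j v).mono_left (hblob_free j)).symm
    · exact (hfree_ball i w).mono_left (hblob_free i)
    · exact (hfree_disj i j fun h' => h (by rw [h'])).mono (hblob_free i) (hblob_free j)
  · rintro (v | i)
    · simpa using gridConn_gridBlob hδ0 (convex_closedBall (p v) r).isPreconnected
    · simpa using gridConn_setOf_gridReach (free i) (z₀ i)
  · rintro e v (rfl | rfl)
    · simpa using hadj e (src e) (Set.Icc 0 (1 / 2)) (Set.Icc_subset_Icc_right (by norm_num))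
        isPreconnected_Icc ⟨by norm_num, le_rfl⟩ ⟨0, ⟨le_rfl, by norm_num⟩, hγ0 e⟩
        fun w hw => hr3 e w hw
    · simpa using hadj e (tgt e) (Set.Icc (1 / 2) 1) (Set.Icc_subset_Icc_left (by norm_num))
        isPreconnected_Icc ⟨le_rfl, by norm_num⟩ ⟨1, ⟨by norm_num, le_rfl⟩, hγ1 e⟩
        fun w hw => hr4 e w hw

end Approximation

/-- The endpoints of a set of oriented edges. -/
def edgeVerts {V : Type*} [DecidableEq V] (K : Finset (V × V)) : Finset V :=
  K.image Prod.fst ∪ K.image Prod.snd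

/-- A nonempty finite set is a cluster for the relation `R` if `R` connects it. -/
def IsCluster {α : Type*} (R : α → α → Prop) (K : Finset α) : Prop :=
  K.Nonempty ∧ ∀ e ∈ K, ∀ f ∈ K,
    Relation.ReflTransGen (fun a b => a ∈ K ∧ b ∈ K ∧ R a b) e f

/-- Two finite sets are independent for the relation `R` if they are disjoint and `R` does not
relate them. -/
def Unrelated {α : Type*} (R : α → α → Prop) (K L : Finset α) : Prop :=
  Disjoint K L ∧ ∀ e ∈ K, ∀ f ∈ L, ¬ R e f

lemma mem_edgeVerts {V : Type*} [DecidableEq V] {K : Finset (V × V)} {v : V} :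
    v ∈ edgeVerts K ↔ ∃ e ∈ K, v = e.1 ∨ v = e.2 := by
  simp only [edgeVerts, Finset.mem_union, Finset.mem_image]
  constructor
  · rintro (⟨e, he, rfl⟩ | ⟨e, he, rfl⟩)
    exacts [⟨e, he, Or.inl rfl⟩, ⟨e, he, Or.inr rfl⟩]
  · rintro ⟨e, he, rfl | rfl⟩
    exacts [Or.inl ⟨e, he, rfl⟩, Or.inr ⟨e, he, rfl⟩]

namespace Drawing

variable {V : Type*} {G : SimpleGraph V}

/-- Two distinct oriented edges are drawn by arcs with intersecting interiors. -/
def Meet (D : Drawing G) (e f : V × V) : Prop :=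
  e ≠ f ∧ ∃ (he : G.Adj e.1 e.2) (hf : G.Adj f.1 f.2), ∃ s ∈ Set.Ioo (0 : ℝ) 1,
    ∃ t ∈ Set.Ioo (0 : ℝ) 1, (D.arc he).extend s = (D.arc hf).extend t

lemma Meet.symm {D : Drawing G} {e f : V × V} (h : D.Meet e f) : D.Meet f e := by
  obtain ⟨hne, he, hf, s, hs, t, ht, h⟩ := h
  exact ⟨hne.symm, hf, he, t, ht, s, hs, h.symm⟩

/-- Independent clusters of edges of a drawing, together with the vertices, are modelled by
connected sets of grid points. -/
lemma exists_grid_model [Finite V] [DecidableEq V] (D : Drawing G) {ι : Type*} [Finite ι]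
    (K : ι → Finset (V × V)) (hK : ∀ i, IsCluster D.Meet (K i))
    (hG : ∀ i, ∀ e ∈ K i, G.Adj e.1 e.2)
    (hind : ∀ i j, i ≠ j → Unrelated D.Meet (K i) (K j)) :
    ∃ B : V ⊕ ι → Finset (ℤ × ℤ), (∀ x, (B x).Nonempty) ∧
      (∀ x y, x ≠ y → Disjoint (B x) (B y)) ∧ (∀ x, GridConn (B x : Set (ℤ × ℤ))) ∧
      ∀ i, ∀ v ∈ edgeVerts (K i),
        ∃ z ∈ B (Sum.inl v), ∃ w ∈ B (Sum.inr i), GridAdj z w := by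
  let adj (x : Σ i, {e // e ∈ K i}) : G.Adj x.2.1.1 x.2.1.2 := hG x.1 _ x.2.2
  obtain ⟨B, h1, h2, h3, h4⟩ := _root_.exists_grid_model (ι := ι) D.pos D.pos_inj
    (ε := Σ i, {e // e ∈ K i}) (fun x => x.2.1.1) (fun x => x.2.1.2) (fun x => x.1)
    (fun i => by
      obtain ⟨e, he⟩ := (hK i).1
      exact ⟨⟨i, e, he⟩, rfl⟩)
    (fun x => (D.arc (adj x)).extend) (fun x => (D.arc (adj x)).continuous_extend)
    (fun x => Path.extend_zero _) (fun x => Path.extend_one _)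
    (by
      intro x t ht w h
      rw [Path.extend_apply _ ⟨ht.1.le, ht.2.le⟩] at h
      rcases D.arc_avoid _ w _ h with h | h
      · exact ht.1.ne' (congrArg Subtype.val h)
      · exact ht.2.ne (congrArg Subtype.val h))
    (by
      rintro ⟨i, e, he⟩ ⟨j, f, hf⟩ (rfl : i = j)
      have key : ∀ f, Relation.ReflTransGen (fun a b => a ∈ K i ∧ b ∈ K i ∧ D.Meet a b) e f →
          ∀ hf : f ∈ K i, Relation.ReflTransGen (fun a b : Σ i, {e // e ∈ K i} => a.1 = b.1 ∧
            ∃ s ∈ Set.Ioo (0 : ℝ) 1, ∃ t ∈ Set.Ioo (0 : ℝ) 1,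
              (D.arc (adj a)).extend s = (D.arc (adj b)).extend t) ⟨i, e, he⟩ ⟨i, f, hf⟩ := by
        intro f h
        induction h with
        | refl => exact fun _ => Relation.ReflTransGen.refl
        | tail _ h ih =>
          intro hf
          obtain ⟨s, hs, t, ht, h'⟩ := h.2.2.2.2.2
          exact (ih h.1).tail ⟨rfl, s, hs, t, ht, h'⟩
      exact key f ((hK i).2 e he f hf) hf)
    (by
      rintro ⟨i, e, he⟩ ⟨j, f, hf⟩ (hij : i ≠ j) s hs t ht h
      exact (hind i j hij).2 e he f hf
        ⟨fun h' => Finset.disjoint_left.1 (hind i j hij).1 he (h' ▸ hf), _, _, s, hs, t, ht, h⟩)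
  refine ⟨B, h1, h2, h3, fun i v hv => ?_⟩
  obtain ⟨e, he, hv⟩ := mem_edgeVerts.1 hv
  exact h4 ⟨i, e, he⟩ v hv

/-- Stars of edges contracted along independent clusters form a planar bipartite graph. -/
theorem sum_card_star_add_four_le [Fintype V] [DecidableEq V] (D : Drawing G) {ι : Type*}
    [Fintype ι] (K : ι → Finset (V × V)) (hK : ∀ i, IsCluster D.Meet (K i))
    (hG : ∀ i, ∀ e ∈ K i, G.Adj e.1 e.2)
    (hind : ∀ i j, i ≠ j → Unrelated D.Meet (K i) (K j)) (col : V → Bool)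
    (hV : 3 ≤ Fintype.card V) (c : ι → V) (hc : ∀ i, c i ∈ edgeVerts (K i))
    (F : ι → Finset (V × V)) (hF : ∀ i j, i ≠ j → Disjoint (F i) (F j))
    (hcol : ∀ i, ∀ f ∈ F i, col f.1 = false ∧ col f.2 = true)
    (hcF : ∀ i, ∀ f ∈ F i, (c i = f.1 ∨ c i = f.2) ∧ f.1 ∈ edgeVerts (K i) ∧
      f.2 ∈ edgeVerts (K i)) :
    ∑ i, (F i).card + 4 ≤ 2 * Fintype.card V := by
  classical
  obtain ⟨B, h1, h2, h3, h4⟩ := D.exists_grid_model K hK hG hind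
  let B' : V → Finset (ℤ × ℤ) := fun v =>
    B (Sum.inl v) ∪ (Finset.univ.filter fun i => c i = v).biUnion fun i => B (Sum.inr i)
  have hB' : ∀ v z, z ∈ B' v ↔ z ∈ B (Sum.inl v) ∨ ∃ i, c i = v ∧ z ∈ B (Sum.inr i) := by
    intro v z; simp [B']
  have huniq : ∀ {x y z}, z ∈ B x → z ∈ B y → x = y := by
    intro x y z hx hy
    by_contra h
    exact Finset.disjoint_left.1 (h2 x y h) hx hy
  rw [← Finset.card_biUnion fun i _ j _ h => hF i j h]
  refine card_add_four_le_of_grid_model _ col ?_ hV B' ?_ ?_ ?_ ?_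
  · intro f hf
    obtain ⟨i, -, hf⟩ := Finset.mem_biUnion.1 hf
    exact hcol i f hf
  · exact fun v => (h1 (Sum.inl v)).mono Finset.subset_union_left
  · intro v w hvw
    refine Finset.disjoint_left.2 fun z hz hz' => ?_
    rw [hB'] at hz hz'
    rcases hz with hz | ⟨i, rfl, hz⟩ <;> rcases hz' with hz' | ⟨j, rfl, hz'⟩
    · exact hvw (Sum.inl_injective (huniq hz hz'))
    · exact Sum.inl_ne_inr (huniq hz hz')
    · exact Sum.inr_ne_inl (huniq hz hz')
    · exact hvw (congrArg c (Sum.inr_injective (huniq hz hz')))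
  · intro v
    have hsub0 : (B (Sum.inl v) : Set (ℤ × ℤ)) ⊆ B' v := fun z hz => (hB' v z).2 (Or.inl hz)
    have key : ∀ z ∈ B' v, ∃ w ∈ B (Sum.inl v), GridReach (B' v) z w := by
      intro z hz
      rcases (hB' v z).1 hz with hz | ⟨i, rfl, hzi⟩
      · exact ⟨z, hz, Relation.ReflTransGen.refl⟩
      · obtain ⟨a, ha, b, hb, hab⟩ := h4 i (c i) (hc i)
        have hsub : (B (Sum.inr i) : Set (ℤ × ℤ)) ⊆ B' (c i) := fun z hz =>
          (hB' _ z).2 (Or.inr ⟨i, rfl, hz⟩)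
        exact ⟨a, ha, ((h3 _ z hzi b hb).mono hsub).tail ⟨hab.symm, hsub hb, hsub0 ha⟩⟩
    intro z hz w hw
    obtain ⟨z', hz', hzz'⟩ := key z hz
    obtain ⟨w', hw', hww'⟩ := key w hw
    exact (hzz'.trans ((h3 _ z' hz' w' hw').mono hsub0)).trans hww'.symm
  · intro f hf
    obtain ⟨i, -, hf⟩ := Finset.mem_biUnion.1 hf
    obtain ⟨h | h, hf1, hf2⟩ := hcF i f hf
    · obtain ⟨z, hz, w, hw, hzw⟩ := h4 i _ hf2
      exact ⟨w, (hB' _ _).2 (Or.inr ⟨i, h, hw⟩), z, (hB' _ _).2 (Or.inl hz), hzw.symm⟩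
    · obtain ⟨z, hz, w, hw, hzw⟩ := h4 i _ hf1
      exact ⟨z, (hB' _ _).2 (Or.inl hz), w, (hB' _ _).2 (Or.inr ⟨i, h, hw⟩), hzw⟩

/-- The incidence graph between vertices and independent clusters is planar bipartite. -/
theorem sum_card_edgeVerts_add_four_le [Fintype V] [DecidableEq V] (D : Drawing G) {ι : Type*}
    [Fintype ι] (K : ι → Finset (V × V)) (hK : ∀ i, IsCluster D.Meet (K i))
    (hG : ∀ i, ∀ e ∈ K i, G.Adj e.1 e.2)
    (hind : ∀ i j, i ≠ j → Unrelated D.Meet (K i) (K j)) (hV : 3 ≤ Fintype.card V) :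
    ∑ i, (edgeVerts (K i)).card + 4 ≤ 2 * (Fintype.card V + Fintype.card ι) := by
  classical
  obtain ⟨B, h1, h2, h3, h4⟩ := D.exists_grid_model K hK hG hind
  have hcard : ∑ i, (edgeVerts (K i)).card = (Finset.univ.biUnion fun i =>
      (edgeVerts (K i)).image fun v =>
        ((Sum.inl v, Sum.inr i) : (V ⊕ ι) × (V ⊕ ι))).card := by
    rw [Finset.card_biUnion]
    · refine Finset.sum_congr rfl fun i _ => (Finset.card_image_of_injective _ ?_).symm
      intro v w h
      simpa using h
    · intro i _ j _ hij
      refine Finset.disjoint_left.2 fun x hx hx' => ?_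
      obtain ⟨v, -, rfl⟩ := Finset.mem_image.1 hx
      obtain ⟨w, -, h⟩ := Finset.mem_image.1 hx'
      exact hij (Sum.inr_injective (congrArg Prod.snd h)).symm
  rw [hcard, ← Fintype.card_sum]
  refine card_add_four_le_of_grid_model _ (fun x => x.isRight) ?_ ?_ B h1 h2 h3 ?_
  · intro f hf
    simp only [Finset.mem_biUnion, Finset.mem_image] at hf
    obtain ⟨i, -, v, -, rfl⟩ := hf
    exact ⟨rfl, rfl⟩
  · rw [Fintype.card_sum]; omega
  · intro f hf
    simp only [Finset.mem_biUnion, Finset.mem_image] at hf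
    obtain ⟨i, -, v, hv, rfl⟩ := hf
    exact h4 i v hv

end Drawing

section Combinatorics

open Relation

/-- The ordered pairs of related elements of `E`. -/
noncomputable def relPairs {α : Type*} (R : α → α → Prop) (E : Finset α) : Finset (α × α) :=
  open Classical in (E ×ˢ E).filter fun x => R x.1 x.2

lemma mem_relPairs {α : Type*} {R : α → α → Prop} {E : Finset α} {x : α × α} :
    x ∈ relPairs R E ↔ (x.1 ∈ E ∧ x.2 ∈ E) ∧ R x.1 x.2 := by
  simp [relPairs]

/-- Removing `T` from `E` destroys the related pairs that meet `T`. -/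
lemma card_relPairs_sdiff_add_le {α : Type*} [DecidableEq α] {R : α → α → Prop}
    (hR : ∀ e f, R e f → R f e) {E T : Finset α} (hT : T ⊆ E) {Q : Finset (α × α)}
    (hQ : ∀ x ∈ Q, x.1 ∈ T ∧ x.2 ∈ E ∧ R x.1 x.2) (hQ' : ∀ x ∈ Q, x.swap ∉ Q) :
    (relPairs R (E \ T)).card + 2 * Q.card ≤ (relPairs R E).card := by
  have h1 : Disjoint Q (Q.image Prod.swap) := by
    refine Finset.disjoint_left.2 fun x hx hx' => ?_
    obtain ⟨y, hy, rfl⟩ := Finset.mem_image.1 hx'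
    exact hQ' y hy hx
  have h2 : Disjoint (relPairs R (E \ T)) (Q ∪ Q.image Prod.swap) := by
    refine Finset.disjoint_left.2 fun x hx hx' => ?_
    rw [mem_relPairs, Finset.mem_sdiff, Finset.mem_sdiff] at hx
    rcases Finset.mem_union.1 hx' with h | h
    · exact hx.1.1.2 (hQ x h).1
    · obtain ⟨y, hy, rfl⟩ := Finset.mem_image.1 h
      exact hx.1.2.2 (hQ y hy).1
  have h3 : relPairs R (E \ T) ∪ (Q ∪ Q.image Prod.swap) ⊆ relPairs R E := by
    intro x hx
    rw [mem_relPairs]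
    rcases Finset.mem_union.1 hx with h | h
    · rw [mem_relPairs, Finset.mem_sdiff, Finset.mem_sdiff] at h
      exact ⟨⟨h.1.1.1, h.1.2.1⟩, h.2⟩
    · rcases Finset.mem_union.1 h with h | h
      · obtain ⟨a, b, c⟩ := hQ x h
        exact ⟨⟨hT a, b⟩, c⟩
      · obtain ⟨y, hy, rfl⟩ := Finset.mem_image.1 h
        obtain ⟨a, b, c⟩ := hQ y hy
        exact ⟨⟨b, hT a⟩, hR _ _ c⟩
  have h4 := Finset.card_le_card h3
  rw [Finset.card_union_of_disjoint h2, Finset.card_union_of_disjoint h1,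
    Finset.card_image_of_injective _ Prod.swap_injective] at h4
  omega

lemma IsCluster.singleton {α : Type*} (R : α → α → Prop) (e : α) : IsCluster R {e} := by
  refine ⟨Finset.singleton_nonempty e, fun a ha b hb => ?_⟩
  rw [Finset.mem_singleton.1 ha, Finset.mem_singleton.1 hb]

lemma IsCluster.insert_of_rel {α : Type*} [DecidableEq α] {R : α → α → Prop}
    (hR : ∀ e f, R e f → R f e) {K : Finset α} (hK : IsCluster R K) {e f : α} (hf : f ∈ K)
    (h : R e f) : IsCluster R (insert e K) := by
  have hmono : ∀ a ∈ K, ∀ b ∈ K, ReflTransGen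
      (fun a b => a ∈ insert e K ∧ b ∈ insert e K ∧ R a b) a b := fun a ha b hb =>
    ReflTransGen.mono (fun _ _ h => ⟨Finset.mem_insert_of_mem h.1,
      Finset.mem_insert_of_mem h.2.1, h.2.2⟩) _ _ (hK.2 a ha b hb)
  have he := Finset.mem_insert_self e K
  have hf' := Finset.mem_insert_of_mem (b := e) hf
  refine ⟨Finset.insert_nonempty _ _, fun a ha b hb => ?_⟩
  rcases Finset.mem_insert.1 ha with rfl | ha' <;> rcases Finset.mem_insert.1 hb with rfl | hb'
  · exact ReflTransGen.refl
  · exact ReflTransGen.head ⟨he, hf', h⟩ (hmono f hf b hb')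
  · exact (hmono a ha' f hf).tail ⟨hf', he, hR _ _ h⟩
  · exact hmono a ha' b hb'

variable {V : Type*} [DecidableEq V] {R : V × V → V × V → Prop}

/-- The edges in `F` form a star with centre `c` on the vertices of `K`. -/
def IsStarOn (K : Finset (V × V)) (c : V) (F : Finset (V × V)) : Prop :=
  c ∈ edgeVerts K ∧ ∀ f ∈ F, (c = f.1 ∨ c = f.2) ∧ f.1 ∈ edgeVerts K ∧ f.2 ∈ edgeVerts K

/-- There are disjoint stars of edges from `T`, at least `a` edges in total, on
pairwise unrelated clusters contained in `C`. -/
def HasStars (R : V × V → V × V → Prop) (C T : Finset (V × V)) (a : ℕ) : Prop :=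
  ∃ L : List (Finset (V × V) × V × Finset (V × V)),
    (∀ x ∈ L, x.1 ⊆ C ∧ x.2.2 ⊆ T ∧ IsCluster R x.1 ∧ IsStarOn x.1 x.2.1 x.2.2) ∧
    L.Pairwise (fun x y => Unrelated R x.1 y.1 ∧ Disjoint x.2.2 y.2.2) ∧
    a ≤ (L.map fun x => x.2.2.card).sum

/-- There are pairwise unrelated clusters contained in `C` such that the sum of the numbers of
their vertices, each diminished by two, is at least `b`. -/
def HasClusters (R : V × V → V × V → Prop) (C : Finset (V × V)) (b : ℕ) : Prop :=
  ∃ L : List (Finset (V × V)), (∀ K ∈ L, K ⊆ C ∧ IsCluster R K) ∧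
    L.Pairwise (Unrelated R) ∧ b + 2 * L.length ≤ (L.map fun K => (edgeVerts K).card).sum

lemma Unrelated.mono {α : Type*} {R : α → α → Prop} {K K' L L' : Finset α}
    (h : Unrelated R K L) (hK : K' ⊆ K) (hL : L' ⊆ L) : Unrelated R K' L' :=
  ⟨h.1.mono hK hL, fun e he f hf => h.2 e (hK he) f (hL hf)⟩

lemma HasStars.zero (C T : Finset (V × V)) : HasStars R C T 0 :=
  ⟨[], by simp, List.Pairwise.nil, by simp⟩

lemma HasClusters.zero (C : Finset (V × V)) : HasClusters R C 0 :=
  ⟨[], by simp, List.Pairwise.nil, by simp⟩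

lemma HasStars.mono {C C' T T' : Finset (V × V)} {a : ℕ} (h : HasStars R C T a) (hC : C ⊆ C')
    (hT : T ⊆ T') : HasStars R C' T' a := by
  obtain ⟨L, h1, h2, h3⟩ := h
  exact ⟨L, fun x hx => ⟨(h1 x hx).1.trans hC, (h1 x hx).2.1.trans hT, (h1 x hx).2.2⟩, h2, h3⟩

lemma HasStars.of_star {K C T F : Finset (V × V)} {c : V} (hK : IsCluster R K) (hKC : K ⊆ C)
    (hF : F ⊆ T) (h : IsStarOn K c F) : HasStars R C T F.card :=
  ⟨[(K, c, F)], by simpa using ⟨hKC, hF, hK, h⟩, List.pairwise_singleton _ _, by simp⟩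

lemma HasClusters.of_cluster {K C : Finset (V × V)} {b : ℕ} (hK : IsCluster R K) (hKC : K ⊆ C)
    (hb : b + 2 ≤ (edgeVerts K).card) : HasClusters R C b :=
  ⟨[K], by simpa using ⟨hKC, hK⟩, List.pairwise_singleton _ _, by simpa using hb⟩

lemma HasStars.add {C C' D T T' S : Finset (V × V)} {a a' : ℕ} (h : HasStars R C T a)
    (h' : HasStars R C' T' a') (hC : Unrelated R C C') (hT : Disjoint T T')
    (hCD : C ⊆ D) (hCD' : C' ⊆ D) (hTS : T ⊆ S) (hTS' : T' ⊆ S) :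
    HasStars R D S (a + a') := by
  obtain ⟨L, h1, h2, h3⟩ := h
  obtain ⟨L', h1', h2', h3'⟩ := h'
  refine ⟨L ++ L', ?_, List.pairwise_append.2 ⟨h2, h2', ?_⟩, ?_⟩
  · intro x hx
    rcases List.mem_append.1 hx with hx | hx
    · exact ⟨(h1 x hx).1.trans hCD, (h1 x hx).2.1.trans hTS, (h1 x hx).2.2⟩
    · exact ⟨(h1' x hx).1.trans hCD', (h1' x hx).2.1.trans hTS', (h1' x hx).2.2⟩
  · exact fun x hx y hy => ⟨hC.mono (h1 x hx).1 (h1' y hy).1,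
      hT.mono (h1 x hx).2.1 (h1' y hy).2.1⟩
  · simp only [List.map_append, List.sum_append]; omega

lemma HasClusters.add {C C' D : Finset (V × V)} {b b' : ℕ} (h : HasClusters R C b)
    (h' : HasClusters R C' b') (hC : Unrelated R C C') (hCD : C ⊆ D) (hCD' : C' ⊆ D) :
    HasClusters R D (b + b') := by
  obtain ⟨L, h1, h2, h3⟩ := h
  obtain ⟨L', h1', h2', h3'⟩ := h'
  refine ⟨L ++ L', ?_, List.pairwise_append.2 ⟨h2, h2', ?_⟩, ?_⟩
  · intro x hx
    rcases List.mem_append.1 hx with hx | hx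
    · exact ⟨(h1 x hx).1.trans hCD, (h1 x hx).2⟩
    · exact ⟨(h1' x hx).1.trans hCD', (h1' x hx).2⟩
  · exact fun x hx y hy => hC.mono (h1 x hx).1 (h1' y hy).1
  · simp only [List.map_append, List.sum_append, List.length_append]; omega

/-- The edge set `E` supports stars and clusters that account for the excess `6 |E| - 2 C` of
its edges over its crossings. -/
def Accounted (R : V × V → V × V → Prop) (E : Finset (V × V)) : Prop :=
  ∃ a b, HasStars R E E a ∧ HasClusters R E b ∧
    81 * (6 * E.card : ℤ) ≤ 81 * (relPairs R E).card + 2 * (272 * a + 68 * b)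

/-- Local stars and clusters near a set `T` of edges extend an account of `E \ T`. -/
lemma Accounted.of_sdiff (hR : ∀ e f, R e f → R f e) {E T C : Finset (V × V)}
    {Q : Finset ((V × V) × (V × V))} {a b t q : ℕ} (h : Accounted R (E \ T)) (hT : T ⊆ E)
    (hC : C ⊆ T) (hCE : ∀ e ∈ C, ∀ f ∈ E, R e f → f ∈ T)
    (hQ : ∀ x ∈ Q, x.1 ∈ T ∧ x.2 ∈ E ∧ R x.1 x.2) (hQ' : ∀ x ∈ Q, x.swap ∉ Q)
    (ha : HasStars R C T a) (hb : HasClusters R C b) (ht : T.card ≤ t) (hq : q ≤ Q.card)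
    (hle : 81 * (3 * t) ≤ 81 * q + (272 * a + 68 * b)) : Accounted R E := by
  obtain ⟨a', b', ha', hb', h⟩ := h
  have hun : Unrelated R C (E \ T) := by
    refine ⟨Finset.disjoint_sdiff.mono_left hC, fun e he f hf h => ?_⟩
    exact (Finset.mem_sdiff.1 hf).2 (hCE e he f (Finset.mem_sdiff.1 hf).1 h)
  refine ⟨a + a', b + b', ha.add ha' hun Finset.disjoint_sdiff (hC.trans hT)
    Finset.sdiff_subset hT Finset.sdiff_subset, hb.add hb' hun (hC.trans hT)
    Finset.sdiff_subset, ?_⟩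
  have h1 := card_relPairs_sdiff_add_le hR hT hQ hQ'
  have h2 := Finset.card_sdiff_add_card_eq_card hT
  push_cast
  omega

end Combinatorics

section Reduction

variable {V : Type*} [DecidableEq V] {R : V × V → V × V → Prop}

lemma HasStars.single (e : V × V) : HasStars R {e} {e} 1 :=
  HasStars.of_star (c := e.1) (IsCluster.singleton R e) subset_rfl subset_rfl
    (by simp [IsStarOn, edgeVerts])

lemma isCluster_pair (hR : ∀ e f, R e f → R f e) {e f : V × V} (h : R e f) :
    IsCluster R {e, f} :=
  (IsCluster.singleton R f).insert_of_rel hR (Finset.mem_singleton_self f) h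

lemma isCluster_triple (hR : ∀ e f, R e f → R f e) {x y z : V × V} (h : R x y) (h' : R y z) :
    IsCluster R {x, y, z} :=
  (isCluster_pair hR h').insert_of_rel hR (Finset.mem_insert_self y _) h

lemma HasStars.cherry (hR : ∀ e f, R e f → R f e) {e f : V × V} (hne : e ≠ f) (h : R e f)
    (hs : e.1 = f.1 ∨ e.2 = f.2) : HasStars R {e, f} {e, f} 2 := by
  rw [← Finset.card_pair hne]
  rcases hs with hs | hs
  · exact HasStars.of_star (c := e.1) (isCluster_pair hR h) subset_rfl subset_rfl
      (by simp [IsStarOn, edgeVerts, hs])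
  · exact HasStars.of_star (c := e.2) (isCluster_pair hR h) subset_rfl subset_rfl
      (by simp [IsStarOn, edgeVerts, hs])

lemma HasStars.two {x y : V × V} {C : Finset (V × V)} (hne : x ≠ y) (h : ¬ R x y) (hx : x ∈ C)
    (hy : y ∈ C) {T : Finset (V × V)} (hT : C ⊆ T) : HasStars R C T 2 :=
  (HasStars.single x).add (HasStars.single y) (by simp [Unrelated, hne, h]) (by simpa using hne)
    (by simpa using hx) (by simpa using hy) (by simpa using hT hx) (by simpa using hT hy)

/-- The situation of the induction step for the edge set `E`. -/
structure Reducible (R : V × V → V × V → Prop) (E : Finset (V × V)) : Prop where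
  symm : ∀ e f, R e f → R f e
  irrefl : ∀ e, ¬ R e e
  bip : ∀ e ∈ E, ∀ f ∈ E, e.1 ≠ f.2
  ih : ∀ T ⊆ E, T.Nonempty → Accounted R (E \ T)

lemma card_edgeVerts {K : Finset (V × V)} (h : ∀ e ∈ K, ∀ f ∈ K, e.1 ≠ f.2) :
    (edgeVerts K).card = (K.image Prod.fst).card + (K.image Prod.snd).card := by
  refine Finset.card_union_of_disjoint (Finset.disjoint_left.2 fun v hv hv' => ?_)
  obtain ⟨e, he, rfl⟩ := Finset.mem_image.1 hv
  obtain ⟨f, hf, h'⟩ := Finset.mem_image.1 hv'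
  exact h e he f hf h'.symm

lemma two_le_card_image {α β : Type*} [DecidableEq β] {K : Finset α} (g : α → β) {x y : α}
    (hx : x ∈ K) (hy : y ∈ K) (h : g x ≠ g y) : 2 ≤ (K.image g).card :=
  Finset.one_lt_card.2 ⟨_, Finset.mem_image_of_mem g hx, _, Finset.mem_image_of_mem g hy, h⟩

lemma three_le_card_image {α β : Type*} [DecidableEq β] {K : Finset α} (g : α → β) {x y z : α}
    (hx : x ∈ K) (hy : y ∈ K) (hz : z ∈ K) (hxy : g x ≠ g y) (hxz : g x ≠ g z)
    (hyz : g y ≠ g z) : 3 ≤ (K.image g).card :=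
  Finset.two_lt_card.2 ⟨_, Finset.mem_image_of_mem g hx, _, Finset.mem_image_of_mem g hy, _,
    Finset.mem_image_of_mem g hz, hxy, hxz, hyz⟩

lemma four_le_card_edgeVerts {K : Finset (V × V)} (h : ∀ e ∈ K, ∀ f ∈ K, e.1 ≠ f.2)
    (hK : 3 ≤ K.card) : 4 ≤ (edgeVerts K).card := by
  rw [card_edgeVerts h]
  have h1 : K.card ≤ (K.image Prod.fst).card * (K.image Prod.snd).card := by
    rw [← Finset.card_product]
    exact Finset.card_le_card fun e he => Finset.mem_product.2
      ⟨Finset.mem_image_of_mem _ he, Finset.mem_image_of_mem _ he⟩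
  by_contra! hlt
  have h2 : (K.image Prod.fst).card ≤ 3 := by omega
  interval_cases (K.image Prod.fst).card <;> omega

namespace Reducible

variable {E : Finset (V × V)}

lemma of_three_le_degree (h : Reducible R E) {e x y z : V × V} (he : e ∈ E) (hx : x ∈ E)
    (hy : y ∈ E) (hz : z ∈ E) (hxy : x ≠ y) (hxz : x ≠ z) (hyz : y ≠ z) (hex : R e x)
    (hey : R e y) (hez : R e z) : Accounted R E := by
  have hirr := h.irrefl
  refine (h.ih {e} (by simpa using he) ⟨e, by simp⟩).of_sdiff h.symm (C := ∅)
    (Q := {(e, x), (e, y), (e, z)}) (by simpa using he) (by simp) (by simp) ?_ ?_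
    (HasStars.zero _ _) (HasClusters.zero _) (t := 1) (q := 3) ?_ ?_ (by norm_num)
  · grind
  · grind
  · simp
  · grind

lemma of_isolated (h : Reducible R E) {e : V × V} (he : e ∈ E) (hN : ∀ f ∈ E, ¬ R e f) :
    Accounted R E := by
  refine (h.ih {e} (by simpa using he) ⟨e, by simp⟩).of_sdiff h.symm (C := {e})
    (Q := ∅) (by simpa using he) (by simp) (by grind) (by simp) (by simp)
    (HasStars.single e) (HasClusters.zero _) (t := 1) (q := 0) (by simp) (by simp) (by norm_num)

lemma of_path_two (h : Reducible R E) {x y : V × V} (hx : x ∈ E) (hy : y ∈ E) (hxy : R x y)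
    (hNx : ∀ f ∈ E, R x f → f = y) (hNy : ∀ f ∈ E, R y f → f = x) : Accounted R E := by
  have hirr := h.irrefl
  have hT : ({x, y} : Finset (V × V)) ⊆ E := by grind
  have hne : x ≠ y := by rintro rfl; exact hirr _ hxy
  have step : ∀ a b, HasStars R {x, y} {x, y} a → HasClusters R {x, y} b →
      405 ≤ 272 * a + 68 * b → Accounted R E := by
    intro a b ha hb hab
    refine (h.ih _ hT ⟨x, by simp⟩).of_sdiff h.symm (Q := {(x, y)}) hT subset_rfl (by grind)
      (by grind) (by grind) ha hb (t := 2) (q := 1) Finset.card_le_two (by simp) (by omega)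
  by_cases hs : x.1 = y.1 ∨ x.2 = y.2
  · exact step 2 0 (HasStars.cherry h.symm hne hxy hs) (HasClusters.zero _) (by norm_num)
  · refine step 1 2 (HasStars.of_star (c := x.1) (F := {x}) (IsCluster.singleton R x) (by simp)
      (by simp) (by simp [IsStarOn, edgeVerts])) ?_ (by norm_num)
    refine HasClusters.of_cluster (isCluster_pair h.symm hxy) subset_rfl ?_
    rw [card_edgeVerts fun e he f hf => h.bip e (hT he) f (hT hf)]
    push Not at hs
    have h1 := two_le_card_image (K := {x, y}) Prod.fst (x := x) (y := y) (by simp) (by simp) hs.1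
    have h2 := two_le_card_image (K := {x, y}) Prod.snd (x := x) (y := y) (by simp) (by simp) hs.2
    omega

lemma of_path_three (h : Reducible R E) {x y z : V × V} (hx : x ∈ E) (hy : y ∈ E) (hz : z ∈ E)
    (hxy : R x y) (hyz : R y z) (hne : x ≠ z)
    (hNx : ∀ f ∈ E, R x f → f = y) (hNy : ∀ f ∈ E, R y f → f = x ∨ f = z)
    (hNz : ∀ f ∈ E, R z f → f = y) : Accounted R E := by
  have hirr := h.irrefl
  have hT : ({x, y, z} : Finset (V × V)) ⊆ E := by grind
  refine (h.ih _ hT ⟨x, by simp⟩).of_sdiff h.symm (Q := {(x, y), (y, z)}) hT subset_rfl (by grind)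
    (by grind) (by grind) (HasStars.two (x := x) (y := z) hne (by grind) (by simp) (by simp)
      subset_rfl)
    (HasClusters.of_cluster (b := 2) (isCluster_triple h.symm hxy hyz) subset_rfl
      (four_le_card_edgeVerts (fun e he f hf => h.bip e (hT he) f (hT hf)) (by grind)))
    (t := 3) (q := 2) Finset.card_le_three (by grind) (by norm_num)

lemma of_path_four (h : Reducible R E) {w x y z : V × V} (hw : w ∈ E) (hx : x ∈ E) (hy : y ∈ E)
    (hz : z ∈ E) (hwx : R w x) (hxy : R x y) (hyz : R y z) (hwy : w ≠ y) (hxz : x ≠ z)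
    (hNw : ∀ f ∈ E, R w f → f = x) (hNx : ∀ f ∈ E, R x f → f = w ∨ f = y)
    (hNy : ∀ f ∈ E, R y f → f = x ∨ f = z) (hNz : ∀ f ∈ E, R z f → f = y) :
    Accounted R E := by
  have hirr := h.irrefl
  have hsymm := h.symm
  have hT : ({w, x, y, z} : Finset (V × V)) ⊆ E := by grind
  have hcol : ∀ K ⊆ ({w, x, y, z} : Finset (V × V)), ∀ e ∈ K, ∀ f ∈ K, e.1 ≠ f.2 :=
    fun K hK e he f hf => h.bip e (hT (hK he)) f (hT (hK hf))
  have hwx' : w ≠ x := by grind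
  have hxy' : x ≠ y := by grind
  have hyz' : y ≠ z := by grind
  have hwz' : w ≠ z := by grind
  have step : ∀ a b, HasStars R {w, x, y, z} {w, x, y, z} a → HasClusters R {w, x, y, z} b →
      729 ≤ 272 * a + 68 * b → Accounted R E := by
    intro a b ha hb hab
    refine (h.ih _ hT ⟨w, by simp⟩).of_sdiff h.symm (Q := {(w, x), (x, y), (y, z)}) hT
      subset_rfl (by grind) (by grind) (by grind) ha hb (t := 4) (q := 3) Finset.card_le_four
      (by grind) (by omega)
  have hun : Unrelated R {w, x} {z} :=
    ⟨by simp [hwz'.symm, hxz.symm], by grind⟩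
  by_cases hs : w.1 = x.1 ∨ w.2 = x.2
  · exact step 3 0 ((HasStars.cherry h.symm hwx' hwx hs).add (HasStars.single z) hun hun.1
      (by grind) (by grind) (by grind) (by grind)) (HasClusters.zero _) (by norm_num)
  push Not at hs
  by_cases hg : (y.1 = w.1 ∨ y.1 = x.1) ∧ (y.2 = w.2 ∨ y.2 = x.2)
  · have hstar : HasStars R {w, x} {w, y} 2 := by
      rw [← Finset.card_pair hwy]
      have hv : w.1 ∈ edgeVerts {w, x} ∧ x.1 ∈ edgeVerts {w, x} ∧ w.2 ∈ edgeVerts {w, x} ∧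
        x.2 ∈ edgeVerts {w, x} := by simp [edgeVerts]
      by_cases h1 : w.1 = y.1
      · exact HasStars.of_star (c := w.1) (isCluster_pair h.symm hwx) subset_rfl subset_rfl
          ⟨hv.1, by grind⟩
      · have h2 : w.2 = y.2 := by
          by_contra h2
          exact hxy' (Prod.ext (by grind) (by grind))
        exact HasStars.of_star (c := w.2) (isCluster_pair h.symm hwx) subset_rfl subset_rfl
          ⟨hv.2.2.1, by grind⟩
    exact step 3 0 (hstar.add (HasStars.single z) hun (by simp [hwz'.symm, hyz'.symm])
      (by grind) (by grind) (by grind) (by grind)) (HasClusters.zero _) (by norm_num)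
  · refine step 2 3 (HasStars.two (x := w) (y := y) hwy (by grind) (by grind) (by grind)
      subset_rfl) (HasClusters.of_cluster (K := {w, x, y}) (isCluster_triple h.symm hwx hxy)
      (by grind) ?_) (by norm_num)
    rw [card_edgeVerts (hcol _ (by grind))]
    have h1 := two_le_card_image (K := {w, x, y}) Prod.fst (x := w) (y := x) (by simp) (by simp)
      hs.1
    have h2 := two_le_card_image (K := {w, x, y}) Prod.snd (x := w) (y := x) (by simp) (by simp)
      hs.2
    rw [not_and_or, not_or, not_or] at hg
    rcases hg with hg | hg
    · have h3 := three_le_card_image (K := {w, x, y}) Prod.fst (x := w) (y := x) (z := y)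
        (by simp) (by simp) (by simp) hs.1 (Ne.symm hg.1) (Ne.symm hg.2)
      omega
    · have h3 := three_le_card_image (K := {w, x, y}) Prod.snd (x := w) (y := x) (z := y)
        (by simp) (by simp) (by simp) hs.2 (Ne.symm hg.1) (Ne.symm hg.2)
      omega

lemma of_path_end (h : Reducible R E) {w x y z u : V × V} (hw : w ∈ E) (hx : x ∈ E) (hy : y ∈ E)
    (hz : z ∈ E) (hu : u ∈ E) (hwx : R w x) (hxy : R x y) (hyz : R y z) (hzu : R z u)
    (hwy : w ≠ y) (hxz : x ≠ z) (hyu : y ≠ u)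
    (hNw : ∀ f ∈ E, R w f → f = x) (hNx : ∀ f ∈ E, R x f → f = w ∨ f = y)
    (hNy : ∀ f ∈ E, R y f → f = x ∨ f = z) : Accounted R E := by
  have hirr := h.irrefl
  have hsymm := h.symm
  have hT : ({w, x, y, z} : Finset (V × V)) ⊆ E := by grind
  have hwx' : w ≠ x := by grind
  have hxy' : x ≠ y := by grind
  refine (h.ih _ hT ⟨w, by simp⟩).of_sdiff h.symm (C := {w, x, y})
    (Q := {(w, x), (x, y), (y, z), (z, u)}) hT
    (by grind) (by grind) (by simp [hx, hy, hz, hu, hwx, hxy, hyz, hzu])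
    (by simp only [Finset.mem_insert, Finset.mem_singleton, forall_eq_or_imp, forall_eq,
          Prod.swap_prod_mk, Prod.mk.injEq]; grind)
    (HasStars.two (x := w) (y := y) hwy (by grind) (by grind) (by grind) (by grind))
    (HasClusters.of_cluster (b := 2) (K := {w, x, y}) (isCluster_triple h.symm hwx hxy)
      subset_rfl (four_le_card_edgeVerts (fun e he f hf => h.bip e (by grind) f (by grind))
      (by grind))) (t := 4) (q := 4) Finset.card_le_four (by grind) (by norm_num)

lemma of_triangle (h : Reducible R E) {x y z : V × V} (hx : x ∈ E) (hy : y ∈ E)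
    (hz : z ∈ E) (hxy : R x y) (hyz : R y z) (hzx : R z x)
    (hNx : ∀ f ∈ E, R x f → f = y ∨ f = z)
    (hNy : ∀ f ∈ E, R y f → f = x ∨ f = z) (hNz : ∀ f ∈ E, R z f → f = x ∨ f = y) :
    Accounted R E := by
  have hirr := h.irrefl
  have hsymm := h.symm
  have hT : ({x, y, z} : Finset (V × V)) ⊆ E := by grind
  have hxy' : x ≠ y := by grind
  have hyz' : y ≠ z := by grind
  have hzx' : z ≠ x := by grind
  have step : ∀ a b, HasStars R {x, y, z} {x, y, z} a → HasClusters R {x, y, z} b →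
      486 ≤ 272 * a + 68 * b → Accounted R E := by
    intro a b ha hb hab
    refine (h.ih _ hT ⟨x, by simp⟩).of_sdiff h.symm (Q := {(x, y), (y, z), (z, x)}) hT
      subset_rfl (by grind) (by simp [hx, hy, hz, hxy, hyz, hzx]) (by grind) ha hb
      (t := 3) (q := 3) Finset.card_le_three
      (by grind) (by omega)
  have cherry : ∀ e f, e ≠ f → R e f → e ∈ ({x, y, z} : Finset (V × V)) →
      f ∈ ({x, y, z} : Finset (V × V)) → ¬ Accounted R E → e.1 ≠ f.1 ∧ e.2 ≠ f.2 := by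
    intro e f hne hef he hf hcon
    by_contra hs
    rw [not_and_or, not_not, not_not] at hs
    exact hcon (step 2 0 ((HasStars.cherry h.symm hne hef hs).mono (by grind) (by grind))
      (HasClusters.zero _) (by norm_num))
  by_contra hcon
  have c1 := cherry x y hxy' hxy (by simp) (by simp) hcon
  have c2 := cherry y z hyz' hyz (by simp) (by simp) hcon
  have c3 := cherry z x hzx' hzx (by simp) (by simp) hcon
  refine hcon (step 1 4 (HasStars.of_star (c := x.1) (F := {x}) (IsCluster.singleton R x)
    (by simp) (by simp) (by simp [IsStarOn, edgeVerts]))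
    (HasClusters.of_cluster (isCluster_triple h.symm hxy hyz) subset_rfl ?_) (by norm_num))
  rw [card_edgeVerts fun e he f hf => h.bip e (hT he) f (hT hf)]
  have h1 := three_le_card_image (K := {x, y, z}) Prod.fst (x := x) (y := y) (z := z)
    (by simp) (by simp) (by simp) c1.1 c3.1.symm c2.1
  have h2 := three_le_card_image (K := {x, y, z}) Prod.snd (x := x) (y := y) (z := z)
    (by simp) (by simp) (by simp) c1.2 c3.2.symm c2.2
  omega

lemma of_four_cycle (h : Reducible R E) {w x y z : V × V} (hw : w ∈ E) (hx : x ∈ E) (hy : y ∈ E)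
    (hz : z ∈ E) (hwx : R w x) (hxy : R x y) (hyz : R y z) (hzw : R z w) (hwy : w ≠ y)
    (hxz : x ≠ z)
    (hNw : ∀ f ∈ E, R w f → f = x ∨ f = z) (hNx : ∀ f ∈ E, R x f → f = w ∨ f = y)
    (hNy : ∀ f ∈ E, R y f → f = x ∨ f = z) (hNz : ∀ f ∈ E, R z f → f = y ∨ f = w) :
    Accounted R E := by
  have hirr := h.irrefl
  have hsymm := h.symm
  have hT : ({w, x, y, z} : Finset (V × V)) ⊆ E := by grind
  refine (h.ih _ hT ⟨w, by simp⟩).of_sdiff h.symm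
    (Q := {(w, x), (x, y), (y, z), (z, w)}) hT
    subset_rfl (by grind) (by simp [hw, hx, hy, hz, hwx, hxy, hyz, hzw])
    (by simp only [Finset.mem_insert, Finset.mem_singleton, forall_eq_or_imp, forall_eq,
          Prod.swap_prod_mk, Prod.mk.injEq]; grind)
    (HasStars.two (x := w) (y := y) hwy (by grind) (by grind) (by grind) subset_rfl)
    (HasClusters.of_cluster (b := 2) (K := {w, x, y}) (isCluster_triple h.symm hwx hxy)
      (by grind) (four_le_card_edgeVerts (fun e he f hf => h.bip e (by grind) f (by grind))
      (by grind))) (t := 4) (q := 4) Finset.card_le_four (by grind) (by norm_num)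

lemma of_five_cycle_of_cherry (h : Reducible R E) {u w x y z : V × V} (hu : u ∈ E) (hw : w ∈ E)
    (hx : x ∈ E) (hy : y ∈ E) (hz : z ∈ E) (huw : R u w) (hwx : R w x) (hxy : R x y)
    (hyz : R y z) (hzu : R z u)
    (hd : u ≠ w ∧ u ≠ x ∧ u ≠ y ∧ u ≠ z ∧ w ≠ x ∧ w ≠ y ∧ w ≠ z ∧ x ≠ y ∧ x ≠ z ∧ y ≠ z)
    (hNu : ∀ f ∈ E, R u f → f = z ∨ f = w)
    (hNw : ∀ f ∈ E, R w f → f = u ∨ f = x) (hNx : ∀ f ∈ E, R x f → f = w ∨ f = y)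
    (hNy : ∀ f ∈ E, R y f → f = x ∨ f = z) (hNz : ∀ f ∈ E, R z f → f = y ∨ f = u)
    (hs : u.1 = w.1 ∨ u.2 = w.2) : Accounted R E := by
  have hirr := h.irrefl
  have hsymm := h.symm
  have hT : ({u, w, x, y, z} : Finset (V × V)) ⊆ E := by grind
  obtain ⟨hd1, hd2, hd3, hd4, hd5, hd6, hd7, hd8, hd9, hd10⟩ := hd
  have hun : Unrelated R {u, w} {y} :=
    ⟨by simp [hd3.symm, hd6.symm], by grind⟩
  refine (h.ih _ hT ⟨w, by simp⟩).of_sdiff h.symm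
    (Q := {(u, w), (w, x), (x, y), (y, z), (z, u)}) hT
    subset_rfl (by grind) (by simp [hu, hw, hx, hy, hz, huw, hwx, hxy, hyz, hzu])
    (by simp only [Finset.mem_insert, Finset.mem_singleton, forall_eq_or_imp, forall_eq,
          Prod.swap_prod_mk, Prod.mk.injEq]; grind)
    ((HasStars.cherry h.symm hd1 huw hs).add (HasStars.single y) hun hun.1
      (by grind) (by grind) (by grind) (by grind)) (HasClusters.zero _)
    (t := 5) (q := 5) Finset.card_le_five (by grind) (by norm_num)

lemma three_le_card_image_of_five_cycle {α β : Type*} [DecidableEq β] {K : Finset α} (g : α → β)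
    {u w x y z : α} (hu : u ∈ K) (hw : w ∈ K) (hx : x ∈ K) (hy : y ∈ K) (hz : z ∈ K)
    (h1 : g u ≠ g w) (h2 : g w ≠ g x) (h3 : g x ≠ g y) (h4 : g y ≠ g z) (h5 : g z ≠ g u) :
    3 ≤ (K.image g).card := by
  by_cases h : g u = g x
  · exact three_le_card_image g hu hy hz (h ▸ h3) h5.symm h4
  · exact three_le_card_image g hu hw hx h1 h h2

lemma of_five_cycle (h : Reducible R E) {u w x y z : V × V} (hu : u ∈ E) (hw : w ∈ E)
    (hx : x ∈ E) (hy : y ∈ E) (hz : z ∈ E) (huw : R u w) (hwx : R w x) (hxy : R x y)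
    (hyz : R y z) (hzu : R z u)
    (hd : u ≠ w ∧ u ≠ x ∧ u ≠ y ∧ u ≠ z ∧ w ≠ x ∧ w ≠ y ∧ w ≠ z ∧ x ≠ y ∧ x ≠ z ∧ y ≠ z)
    (hNu : ∀ f ∈ E, R u f → f = z ∨ f = w)
    (hNw : ∀ f ∈ E, R w f → f = u ∨ f = x) (hNx : ∀ f ∈ E, R x f → f = w ∨ f = y)
    (hNy : ∀ f ∈ E, R y f → f = x ∨ f = z) (hNz : ∀ f ∈ E, R z f → f = y ∨ f = u) :
    Accounted R E := by
  have hirr := h.irrefl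
  have hsymm := h.symm
  have hT : ({u, w, x, y, z} : Finset (V × V)) ⊆ E := by grind
  by_contra hcon
  have c1 := mt (h.of_five_cycle_of_cherry hu hw hx hy hz huw hwx hxy hyz hzu hd hNu hNw hNx hNy
    hNz) hcon
  have c2 := mt (h.of_five_cycle_of_cherry hw hx hy hz hu hwx hxy hyz hzu huw (by grind) hNw hNx
    hNy hNz hNu) hcon
  have c3 := mt (h.of_five_cycle_of_cherry hx hy hz hu hw hxy hyz hzu huw hwx (by grind) hNx
    hNy hNz hNu hNw) hcon
  have c4 := mt (h.of_five_cycle_of_cherry hy hz hu hw hx hyz hzu huw hwx hxy (by grind)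
    hNy hNz hNu hNw hNx) hcon
  have c5 := mt (h.of_five_cycle_of_cherry hz hu hw hx hy hzu huw hwx hxy hyz (by grind)
    hNz hNu hNw hNx hNy) hcon
  rw [not_or] at c1 c2 c3 c4 c5
  have hK : IsCluster R {u, w, x, y, z} :=
    ((isCluster_triple h.symm hxy hyz).insert_of_rel h.symm (by simp) hwx).insert_of_rel h.symm
      (by simp) huw
  obtain ⟨hd1, hd2, hd3, hd4, hd5, hd6, hd7, hd8, hd9, hd10⟩ := hd
  refine hcon ((h.ih _ hT ⟨w, by simp⟩).of_sdiff h.symm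
    (Q := {(u, w), (w, x), (x, y), (y, z), (z, u)}) hT
    subset_rfl (by grind) (by simp [hu, hw, hx, hy, hz, huw, hwx, hxy, hyz, hzu])
    (by simp only [Finset.mem_insert, Finset.mem_singleton, forall_eq_or_imp, forall_eq,
          Prod.swap_prod_mk, Prod.mk.injEq]; grind)
    (HasStars.two (x := u) (y := x) hd2 (by grind) (by grind) (by grind) subset_rfl)
    (HasClusters.of_cluster (b := 4) hK subset_rfl ?_)
    (t := 5) (q := 5) Finset.card_le_five (by grind) (by norm_num))
  rw [card_edgeVerts fun e he f hf => h.bip e (hT he) f (hT hf)]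
  have h1 := three_le_card_image_of_five_cycle (K := {u, w, x, y, z}) Prod.fst (u := u) (w := w)
    (x := x) (y := y) (z := z) (by simp) (by simp) (by simp) (by simp) (by simp)
    c1.1 c2.1 c3.1 c4.1 c5.1
  have h2 := three_le_card_image_of_five_cycle (K := {u, w, x, y, z}) Prod.snd (u := u) (w := w)
    (x := x) (y := y) (z := z) (by simp) (by simp) (by simp) (by simp) (by simp)
    c1.2 c2.2 c3.2 c4.2 c5.2
  omega

lemma of_long_path_of_cherry (h : Reducible R E) {l2 l1 c r1 r2 r3 : V × V} (hl2 : l2 ∈ E)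
    (hl1 : l1 ∈ E) (hc : c ∈ E) (hr1 : r1 ∈ E) (hr2 : r2 ∈ E) (hr3 : r3 ∈ E) (h1 : R l1 l2)
    (h2 : R l1 c) (h3 : R c r1) (h4 : R r1 r2) (h5 : R r2 r3)
    (hd : l1 ≠ l2 ∧ l2 ≠ c ∧ l2 ≠ r1 ∧ l2 ≠ r2 ∧ l1 ≠ c ∧ l1 ≠ r1 ∧ l1 ≠ r2 ∧ c ≠ r1 ∧ c ≠ r2 ∧
      r1 ≠ r2)
    (hr13 : r1 ≠ r3) (hNc : ∀ f ∈ E, R c f → f = l1 ∨ f = r1)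
    (hNr : ∀ f ∈ E, R r1 f → f = c ∨ f = r2)
    (hs : c.1 = r1.1 ∨ c.2 = r1.2) : Accounted R E := by
  have hT : ({l1, c, r1, r2} : Finset (V × V)) ⊆ E := by grind
  obtain ⟨hd1, hd2, hd3, hd4, hd5, hd6, hd7, hd8, hd9, hd10⟩ := hd
  have h23 : r2 ≠ r3 := by
    rintro rfl
    exact h.irrefl _ h5
  have hbip : ∀ e ∈ ({c, r1} : Finset (V × V)), ∀ f ∈ ({c, r1} : Finset (V × V)), e.1 ≠ f.2 :=
    fun e he f hf => h.bip e (by grind) f (by grind)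
  have hcard : 3 ≤ (edgeVerts {c, r1}).card := by
    rw [card_edgeVerts hbip]
    have p1 : 0 < (({c, r1} : Finset (V × V)).image Prod.fst).card := by simp [Finset.card_pos]
    have p2 : 0 < (({c, r1} : Finset (V × V)).image Prod.snd).card := by simp [Finset.card_pos]
    by_cases h' : c.1 = r1.1
    · have := two_le_card_image (K := {c, r1}) Prod.snd (x := c) (y := r1) (by simp) (by simp)
        (fun h'' => hd8 (Prod.ext h' h''))
      omega
    · have := two_le_card_image (K := {c, r1}) Prod.fst (x := c) (y := r1) (by simp) (by simp) h'
      omega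
  refine (h.ih _ hT ⟨c, by simp⟩).of_sdiff h.symm (C := {c, r1})
    (Q := {(l1, l2), (l1, c), (c, r1), (r1, r2), (r2, r3)}) hT
    (by grind) (by grind) (by simp [*])
    (by clear hNc hNr; simp only [Finset.mem_insert, Finset.mem_singleton, forall_eq_or_imp,
          forall_eq, Prod.swap_prod_mk, Prod.mk.injEq]; grind)
    ((HasStars.cherry h.symm hd8 h3 hs).mono subset_rfl (by grind))
    (HasClusters.of_cluster (b := 1) (K := {c, r1}) (isCluster_pair h.symm h3)
      subset_rfl hcard) (t := 4) (q := 5) Finset.card_le_four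
      (by clear hNc hNr; grind) (by norm_num)

lemma of_long_path (h : Reducible R E) {l3 l2 l1 c r1 r2 r3 : V × V} (hl3 : l3 ∈ E) (hl2 : l2 ∈ E)
    (hl1 : l1 ∈ E) (hc : c ∈ E) (hr1 : r1 ∈ E) (hr2 : r2 ∈ E) (hr3 : r3 ∈ E) (h0 : R l2 l3)
    (h1 : R l1 l2)
    (h2 : R l1 c) (h3 : R c r1) (h4 : R r1 r2) (h5 : R r2 r3)
    (hd : l1 ≠ l2 ∧ l2 ≠ c ∧ l2 ≠ r1 ∧ l2 ≠ r2 ∧ l1 ≠ c ∧ l1 ≠ r1 ∧ l1 ≠ r2 ∧ c ≠ r1 ∧ c ≠ r2 ∧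
      r1 ≠ r2) (hl13 : l1 ≠ l3) (hr13 : r1 ≠ r3) (hlr : l2 ≠ r3)
    (hNl : ∀ f ∈ E, R l1 f → f = c ∨ f = l2)
    (hNc : ∀ f ∈ E, R c f → f = l1 ∨ f = r1)
    (hNr : ∀ f ∈ E, R r1 f → f = c ∨ f = r2) : Accounted R E := by
  by_contra hcon
  have c1 := mt (h.of_long_path_of_cherry hl2 hl1 hc hr1 hr2 hr3 h1 h2 h3 h4 h5 hd hr13 hNc hNr)
    hcon
  have c2 := mt (h.of_long_path_of_cherry hr2 hr1 hc hl1 hl2 hl3 h4 (h.symm _ _ h3)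
    (h.symm _ _ h2) h1 h0 (by grind) hl13 (fun f hf hf' => (hNc f hf hf').symm) hNl) hcon
  rw [not_or] at c1 c2
  have hT : ({l2, l1, c, r1, r2} : Finset (V × V)) ⊆ E := by grind
  obtain ⟨hd1, hd2, hd3, hd4, hd5, hd6, hd7, hd8, hd9, hd10⟩ := hd
  have h23 : r2 ≠ r3 := by
    rintro rfl
    exact h.irrefl _ h5
  have h23' : l2 ≠ l3 := by
    rintro rfl
    exact h.irrefl _ h0
  have hnot : ¬ R l1 r1 := fun h' => by grind
  have hbip : ∀ e ∈ ({l1, c, r1} : Finset (V × V)), ∀ f ∈ ({l1, c, r1} : Finset (V × V)),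
      e.1 ≠ f.2 :=
    fun e he f hf => h.bip e (by grind) f (by grind)
  have hcard : 5 ≤ (edgeVerts {l1, c, r1}).card := by
    rw [card_edgeVerts hbip]
    have p1 := two_le_card_image (K := {l1, c, r1}) Prod.snd (x := c) (y := r1) (by simp)
      (by simp) c1.2
    have p2 := two_le_card_image (K := {l1, c, r1}) Prod.fst (x := c) (y := r1) (by simp)
      (by simp) c1.1
    by_cases h' : l1.1 = r1.1
    · have := three_le_card_image (K := {l1, c, r1}) Prod.snd (x := c) (y := r1) (z := l1)
        (by simp) (by simp) (by simp) c1.2 c2.2 (fun h'' => hd6 (Prod.ext h' h''.symm))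
      omega
    · have := three_le_card_image (K := {l1, c, r1}) Prod.fst (x := c) (y := r1) (z := l1)
        (by simp) (by simp) (by simp) c1.1 c2.1 (Ne.symm h')
      omega
  refine hcon ((h.ih _ hT ⟨c, by simp⟩).of_sdiff h.symm (C := {l1, c, r1})
    (Q := {(l2, l3), (l1, l2), (l1, c), (c, r1), (r1, r2), (r2, r3)}) hT
    (by grind) (by grind) (by simp [*])
    (by clear hNc hNr hNl; simp only [Finset.mem_insert, Finset.mem_singleton, forall_eq_or_imp,
          forall_eq, Prod.swap_prod_mk, Prod.mk.injEq]; grind)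
    (HasStars.two (x := l1) (y := r1) hd6 hnot (by simp) (by simp) (by grind))
    (HasClusters.of_cluster (b := 3) (K := {l1, c, r1}) (isCluster_triple h.symm h2 h3)
      subset_rfl hcard) (t := 5) (q := 6) Finset.card_le_five ?_ (by norm_num))
  clear hNc hNr hNl
  rw [Finset.card_insert_of_notMem, Finset.card_insert_of_notMem, Finset.card_insert_of_notMem,
    Finset.card_insert_of_notMem, Finset.card_insert_of_notMem, Finset.card_singleton] <;>
  simp only [Finset.mem_insert, Finset.mem_singleton, Prod.mk.injEq] <;> grind

end Reducible

lemma Reducible.accounted {E : Finset (V × V)} (h : Reducible R E) (hE : E.Nonempty) :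
    Accounted R E := by
  by_contra hcon
  have hirr := h.irrefl
  have hsymm := h.symm
  have N1 : ∀ e ∈ E, ∃ z ∈ E, R e z := by
    intro e he
    by_contra! hno
    exact hcon (h.of_isolated he hno)
  have N2 : ∀ e ∈ E, ∀ z ∈ E, R e z → (∀ f ∈ E, R e f → f = z) ∨
      ∃ y ∈ E, y ≠ z ∧ R e y ∧ ∀ f ∈ E, R e f → f = z ∨ f = y := by
    intro e he z hz hez
    by_contra! hno
    obtain ⟨⟨y, hy, hey, hyz⟩, h2⟩ := hno
    obtain ⟨x, hx, hex, hxz, hxy⟩ := h2 y hy hyz hey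
    exact hcon (h.of_three_le_degree he hz hy hx hyz.symm hxz.symm hxy.symm hez hey hex)
  by_cases hleaf : ∃ w ∈ E, ∃ x ∈ E, R w x ∧ ∀ f ∈ E, R w f → f = x
  · obtain ⟨w, hw, x, hx, hwx, hNw⟩ := hleaf
    rcases N2 x hx w hw (hsymm _ _ hwx) with hNx | ⟨y, hy, hyw, hxy, hNx⟩
    · exact hcon (h.of_path_two hw hx hwx hNw hNx)
    rcases N2 y hy x hx (hsymm _ _ hxy) with hNy | ⟨z, hz, hzx, hyz, hNy⟩
    · exact hcon (h.of_path_three hw hx hy hwx hxy hyw.symm hNw hNx hNy)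
    rcases N2 z hz y hy (hsymm _ _ hyz) with hNz | ⟨u, hu, huy, hzu, hNz⟩
    · exact hcon (h.of_path_four hw hx hy hz hwx hxy hyz hyw.symm hzx.symm hNw hNx hNy hNz)
    · exact hcon (h.of_path_end hw hx hy hz hu hwx hxy hyz hzu hyw.symm hzx.symm huy.symm hNw hNx
        hNy)
  have N3 : ∀ e ∈ E, ∀ z ∈ E, R e z →
      ∃ y ∈ E, y ≠ z ∧ R e y ∧ ∀ f ∈ E, R e f → f = z ∨ f = y := fun e he z hz hez =>
    (N2 e he z hz hez).resolve_left fun h' => hleaf ⟨e, he, z, hz, hez, h'⟩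
  obtain ⟨c, hc⟩ := hE
  obtain ⟨l₁, hl₁, hcl⟩ := N1 c hc
  obtain ⟨r₁, hr₁, hlr, hcr, hNc⟩ := N3 c hc l₁ hl₁ hcl
  obtain ⟨l₂, hl₂, hlc, hll, hNl⟩ := N3 l₁ hl₁ c hc (hsymm _ _ hcl)
  obtain ⟨r₂, hr₂, hrc, hrr, hNr⟩ := N3 r₁ hr₁ c hc (hsymm _ _ hcr)
  have hcl' : c ≠ l₁ := by grind
  have hcr' : c ≠ r₁ := by grind
  by_cases h1 : R l₁ r₁
  · have e1 : r₁ = l₂ := (hNl r₁ hr₁ h1).resolve_left hcr'.symm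
    have e2 : l₁ = r₂ := (hNr l₁ hl₁ (hsymm _ _ h1)).resolve_left hcl'.symm
    subst e1 e2
    exact hcon (h.of_triangle hc hl₁ hr₁ hcl h1 (hsymm _ _ hcr) hNc hNl hNr)
  have hll' : l₁ ≠ l₂ := by grind
  have hrr' : r₁ ≠ r₂ := by grind
  obtain ⟨l₃, hl₃, hl3, hl23, hNl₂⟩ := N3 l₂ hl₂ l₁ hl₁ (hsymm _ _ hll)
  by_cases h2 : l₂ = r₂
  · subst h2
    refine hcon (h.of_four_cycle hc hl₁ hl₂ hr₁ hcl hll (hsymm _ _ hrr) (hsymm _ _ hcr) hlc.symm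
      hlr.symm hNc hNl ?_ ?_)
    · have := (hNl₂ r₁ hr₁ (hsymm _ _ hrr)).resolve_left hlr
      exact this ▸ hNl₂
    · exact fun f hf hf' => (hNr f hf hf').symm
  obtain ⟨r₃, hr₃, hr3, hr23, hNr₂⟩ := N3 r₂ hr₂ r₁ hr₁ (hsymm _ _ hrr)
  have hlr2 : l₂ ≠ r₁ := fun h' => h1 (h' ▸ hll)
  have hrl2 : r₂ ≠ l₁ := fun h' => h1 (hsymm _ _ (h' ▸ hrr))
  by_cases h3 : R l₂ r₂
  · have e1 : r₂ = l₃ := (hNl₂ r₂ hr₂ h3).resolve_left hrl2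
    have e2 : l₂ = r₃ := (hNr₂ l₂ hl₂ (hsymm _ _ h3)).resolve_left hlr2
    subst e1 e2
    exact hcon (h.of_five_cycle hc hl₁ hl₂ hr₂ hr₁ hcl hll h3 (hsymm _ _ hrr) (hsymm _ _ hcr)
      ⟨hcl', hlc.symm, hrc.symm, hcr', hll', hrl2.symm, hlr.symm, h2, hlr2, hrr'.symm⟩
      (fun f hf hf' => (hNc f hf hf').symm) hNl hNl₂ (fun f hf hf' => (hNr₂ f hf hf').symm)
      (fun f hf hf' => (hNr f hf hf').symm))
  · exact hcon (h.of_long_path hl₃ hl₂ hl₁ hc hr₁ hr₂ hr₃ hl23 hll (hsymm _ _ hcl) hcr hrr hr23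
      ⟨hll', hlc, hlr2, h2, hcl'.symm, hlr.symm, hrl2.symm, hcr', hrc.symm, hrr'⟩ hl3.symm hr3.symm
      (fun h' => h3 (hsymm _ _ (h' ▸ hr23))) hNl hNc hNr)

theorem accounted_of_symm (hR : ∀ e f, R e f → R f e) (hR' : ∀ e, ¬ R e e)
    (E : Finset (V × V)) (hE : ∀ e ∈ E, ∀ f ∈ E, e.1 ≠ f.2) : Accounted R E := by
  induction E using Finset.strongInduction with
  | H E ih =>
    rcases E.eq_empty_or_nonempty with rfl | hne
    · exact ⟨0, 0, HasStars.zero _ _, HasClusters.zero _, by simp⟩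
    · exact Reducible.accounted ⟨hR, hR', hE, fun T hT hT' => ih _ (Finset.sdiff_ssubset hT hT')
        fun e he f hf => hE e (Finset.sdiff_subset he) f (Finset.sdiff_subset hf)⟩ hne

end Reduction

lemma HasStars.add_four_le {V : Type*} [Fintype V] [DecidableEq V] {G : SimpleGraph V}
    (D : Drawing G) (col : V → Bool) (hV : 3 ≤ Fintype.card V) {C T : Finset (V × V)} {a : ℕ}
    (h : HasStars D.Meet C T a) (hC : ∀ e ∈ C, G.Adj e.1 e.2)
    (hT : ∀ f ∈ T, col f.1 = false ∧ col f.2 = true) : a + 4 ≤ 2 * Fintype.card V := by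
  obtain ⟨L, h1, h2, h3⟩ := h
  rw [List.pairwise_iff_getElem] at h2
  have hL : ∀ i : Fin L.length, L[i] ∈ L := fun i => List.getElem_mem _
  have hP : ∀ i j : Fin L.length, i ≠ j →
      Unrelated D.Meet L[i].1 L[j].1 ∧ Disjoint L[i].2.2 L[j].2.2 := by
    intro i j hij
    rcases lt_or_gt_of_ne hij with hlt | hlt
    · exact h2 i j i.2 j.2 hlt
    · obtain ⟨⟨p1, p2⟩, p3⟩ := h2 j i j.2 i.2 hlt
      exact ⟨⟨p1.symm, fun e he f hf hef => p2 f hf e he hef.symm⟩, p3.symm⟩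
  have := D.sum_card_star_add_four_le (fun i : Fin L.length => L[i].1)
    (fun i => (h1 _ (hL i)).2.2.1) (fun i e he => hC e ((h1 _ (hL i)).1 he))
    (fun i j hij => (hP i j hij).1) col hV (fun i => L[i].2.1) (fun i => (h1 _ (hL i)).2.2.2.1)
    (fun i => L[i].2.2) (fun i j hij => (hP i j hij).2)
    (fun i f hf => hT f ((h1 _ (hL i)).2.1 hf)) (fun i => (h1 _ (hL i)).2.2.2.2)
  have hsum := Fin.sum_univ_fun_getElem L fun x => x.2.2.card
  simp only [Fin.getElem_fin] at this
  omega

lemma HasClusters.add_four_le {V : Type*} [Fintype V] [DecidableEq V] {G : SimpleGraph V}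
    (D : Drawing G) (hV : 3 ≤ Fintype.card V) {C : Finset (V × V)} {b : ℕ}
    (h : HasClusters D.Meet C b) (hC : ∀ e ∈ C, G.Adj e.1 e.2) :
    b + 4 ≤ 2 * Fintype.card V := by
  obtain ⟨L, h1, h2, h3⟩ := h
  rw [List.pairwise_iff_getElem] at h2
  have hL : ∀ i : Fin L.length, L[i] ∈ L := fun i => List.getElem_mem _
  have hP : ∀ i j : Fin L.length, i ≠ j → Unrelated D.Meet L[i] L[j] := by
    intro i j hij
    rcases lt_or_gt_of_ne hij with hlt | hlt
    · exact h2 i j i.2 j.2 hlt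
    · obtain ⟨p1, p2⟩ := h2 j i j.2 i.2 hlt
      exact ⟨p1.symm, fun e he f hf hef => p2 f hf e he hef.symm⟩
  have := D.sum_card_edgeVerts_add_four_le (fun i : Fin L.length => L[i])
    (fun i => (h1 _ (hL i)).2) (fun i e he => hC e ((h1 _ (hL i)).1 he)) hP hV
  have hsum := Fin.sum_univ_fun_getElem L fun K => (edgeVerts K).card
  simp only [Fin.getElem_fin, Fintype.card_fin] at this
  omega

/-- The edges of `G`, oriented from the colour `false` to the colour `true`. -/
noncomputable def orientedEdges {V : Type*} [Fintype V] (G : SimpleGraph V) (col : V → Bool) :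
    Finset (V × V) :=
  open Classical in
    Finset.univ.filter fun e => (col e.1 = false ∧ col e.2 = true) ∧ G.Adj e.1 e.2

section Oriented

variable {V : Type*} [Fintype V] {G : SimpleGraph V} {col : V → Bool}

lemma mem_orientedEdges {e : V × V} :
    e ∈ orientedEdges G col ↔ (col e.1 = false ∧ col e.2 = true) ∧ G.Adj e.1 e.2 := by
  simp [orientedEdges]

lemma orientedEdges_injOn :
    Set.InjOn (fun e : V × V => s(e.1, e.2)) (orientedEdges G col : Set (V × V)) := by
  rintro ⟨a, b⟩ he ⟨c, d⟩ hf h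
  rw [Finset.mem_coe, mem_orientedEdges] at he hf
  rcases Sym2.eq_iff.1 h with ⟨rfl, rfl⟩ | ⟨rfl, rfl⟩
  · rfl
  · exact absurd (he.1.1.symm.trans hf.1.2) (by simp)

lemma ncard_edgeSet_le_card_orientedEdges (hcol : ∀ ⦃u v⦄, G.Adj u v → col u ≠ col v) :
    G.edgeSet.ncard ≤ (orientedEdges G col).card := by
  rw [← Set.ncard_coe_finset, ← orientedEdges_injOn.ncard_image]
  refine Set.ncard_le_ncard (fun e he => ?_) (Set.toFinite _)
  induction e using Sym2.ind with
  | _ u v =>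
    have h : G.Adj u v := he
    have hne := hcol h
    cases hu : col u
    · refine ⟨(u, v), ?_, rfl⟩
      rw [Finset.mem_coe, mem_orientedEdges]
      exact ⟨⟨hu, by grind⟩, h⟩
    · refine ⟨(v, u), ?_, Sym2.eq_swap⟩
      rw [Finset.mem_coe, mem_orientedEdges]
      exact ⟨⟨by grind, hu⟩, h.symm⟩

end Oriented

namespace Drawing

variable {V : Type*} {G : SimpleGraph V}

lemma mem_edgeInterior (D : Drawing G) {u v : V} (h : G.Adj u v) {p : ℝ × ℝ} :
    p ∈ D.edgeInterior s(u, v) ↔ ∃ t : unitInterval, (t ≠ 0 ∧ t ≠ 1) ∧ D.arc h t = p := by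
  simp only [edgeInterior, Set.mem_iUnion, Set.mem_image, Set.mem_ofPred_eq]
  constructor
  · rintro ⟨a, b, hab, he, t, ht, rfl⟩
    rcases Sym2.eq_iff.1 he with ⟨rfl, rfl⟩ | ⟨rfl, rfl⟩
    · exact ⟨t, ht, rfl⟩
    · refine ⟨unitInterval.symm t, ⟨?_, ?_⟩, ?_⟩
      · simpa [unitInterval.symm_eq_zero] using ht.2
      · simpa [unitInterval.symm_eq_one] using ht.1
      · simp [D.arc_symm hab]
  · rintro ⟨t, ht, rfl⟩
    exact ⟨u, v, h, rfl, t, ht, rfl⟩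

lemma Meet.crosses {D : Drawing G} {e f : V × V} (h : D.Meet e f)
    (hne : s(e.1, e.2) ≠ s(f.1, f.2)) : D.Crosses s(e.1, e.2) s(f.1, f.2) := by
  obtain ⟨-, he, hf, s, hs, t, ht, h⟩ := h
  refine ⟨he, hf, hne, (D.arc he).extend s, (D.mem_edgeInterior he).2 ?_,
    (D.mem_edgeInterior hf).2 ?_⟩
  · refine ⟨⟨s, hs.1.le, hs.2.le⟩, ⟨fun h' => hs.1.ne' (congrArg Subtype.val h'),
      fun h' => hs.2.ne (congrArg Subtype.val h')⟩, ?_⟩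
    rw [Path.extend_apply _ ⟨hs.1.le, hs.2.le⟩]
  · refine ⟨⟨t, ht.1.le, ht.2.le⟩, ⟨fun h' => ht.1.ne' (congrArg Subtype.val h'),
      fun h' => ht.2.ne (congrArg Subtype.val h')⟩, ?_⟩
    rw [h, Path.extend_apply _ ⟨ht.1.le, ht.2.le⟩]

lemma even_ncard_crosses (D : Drawing G) :
    Even {p : Sym2 V × Sym2 V | D.Crosses p.1 p.2}.ncard := by
  classical
  set S := {p : Sym2 V × Sym2 V | D.Crosses p.1 p.2} with hS
  rcases S.finite_or_infinite with hfin | hinf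
  · rw [Set.ncard_eq_toFinset_card S hfin, even_iff_two_dvd, ← ZMod.natCast_eq_zero_iff,
      Finset.card_eq_sum_ones, Nat.cast_sum]
    refine Finset.sum_involution (fun p _ => p.swap) (fun p _ => by decide) ?_ ?_
      (fun p _ => p.swap_swap)
    · intro p hp _ h
      rw [Set.Finite.mem_toFinset] at hp
      exact hp.2.2.1 (congrArg Prod.snd h)
    · intro p hp
      rw [Set.Finite.mem_toFinset] at hp ⊢
      exact ⟨hp.2.1, hp.1, hp.2.2.1.symm, by rw [Set.inter_comm]; exact hp.2.2.2⟩
  · simp [hinf.ncard]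

lemma card_relPairs_le [Fintype V] (D : Drawing G) (col : V → Bool) :
    (relPairs D.Meet (orientedEdges G col)).card ≤ 2 * D.crossCount := by
  rw [crossCount, Nat.two_mul_div_two_of_even D.even_ncard_crosses, ← Set.ncard_coe_finset]
  refine Set.ncard_le_ncard_of_injOn
    (fun x : (V × V) × (V × V) => (s(x.1.1, x.1.2), s(x.2.1, x.2.2))) ?_ ?_ (Set.toFinite _)
  · intro x hx
    rw [Finset.mem_coe, mem_relPairs] at hx
    exact hx.2.crosses fun h => hx.2.1 (orientedEdges_injOn hx.1.1 hx.1.2 h)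
  · intro x hx y hy h
    rw [Finset.mem_coe, mem_relPairs] at hx hy
    rw [Prod.mk.injEq] at h
    exact Prod.ext (orientedEdges_injOn hx.1.1 hy.1.1 h.1) (orientedEdges_injOn hx.1.2 hy.1.2 h.2)

/-- A bipartite drawing has few edges in excess of its crossings. -/
theorem excess_le [Fintype V] (D : Drawing G) (hG : G.Colorable 2)
    (hV : 3 ≤ Fintype.card V) :
    81 * (3 * (G.edgeSet.ncard : ℤ) - D.crossCount) ≤ 340 * (2 * Fintype.card V - 4) := by
  classical
  obtain ⟨c⟩ := hG
  let col : V → Bool := fun v => c v = 1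
  have hcol : ∀ ⦃u v⦄, G.Adj u v → col u ≠ col v := by
    intro u v h h'
    have := c.valid h
    simp only [col, decide_eq_decide] at h'
    omega
  have hE : ∀ e ∈ orientedEdges G col, G.Adj e.1 e.2 := fun e he => (mem_orientedEdges.1 he).2
  have hE' : ∀ e ∈ orientedEdges G col, col e.1 = false ∧ col e.2 = true :=
    fun e he => (mem_orientedEdges.1 he).1
  obtain ⟨a, b, ha, hb, h⟩ := accounted_of_symm (R := D.Meet) (fun e f h => h.symm)
    (fun e h => h.1 rfl) (orientedEdges G col) (fun e he f hf h => by
      have h1 := (hE' e he).1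
      rw [h, (hE' f hf).2] at h1
      exact Bool.noConfusion h1)
  have h1 := ha.add_four_le D col hV hE hE'
  have h2 := hb.add_four_le D hV hE
  have h3 := D.card_relPairs_le col
  have h4 := ncard_edgeSet_le_card_orientedEdges hcol
  omega

/-- Every graph on a finite set of vertices has a drawing. -/
lemma nonempty_of_finite [Finite V] (G : SimpleGraph V) : Nonempty (Drawing G) := by
  obtain ⟨n, ⟨f⟩⟩ := Finite.exists_equiv_fin V
  let g : V → ℝ := fun v => (f v : ℕ)
  have hg : Function.Injective g := fun u v h => f.injective (Fin.ext (Nat.cast_injective h))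
  let pos : V → ℝ × ℝ := fun v => (g v, g v ^ 2)
  have key : ∀ u v : V, ∀ t : unitInterval,
      AffineMap.lineMap (k := ℝ) (pos u) (pos v) (t : ℝ) =
        (g u + t * (g v - g u), g u ^ 2 + t * (g v ^ 2 - g u ^ 2)) := by
    intro u v t
    simp only [AffineMap.lineMap_apply, pos, vsub_eq_sub, vadd_eq_add, Prod.smul_mk, Prod.mk_sub_mk,
      Prod.mk_add_mk, smul_eq_mul]
    ext <;> ring
  refine ⟨{
    pos := pos
    pos_inj := fun u v h => hg (congrArg Prod.fst h)
    arc := fun u v _ => Path.segment (pos u) (pos v)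
    arc_symm := ?_
    arc_inj := ?_
    arc_avoid := ?_ }⟩
  · intro u v h
    ext t <;> simp [key]
  · intro u v h s t hst
    have h1 := congrArg Prod.fst hst
    simp only [Path.segment_apply, key] at h1
    have h2 : g v - g u ≠ 0 := sub_ne_zero.2 fun h' => h.ne (hg h'.symm)
    exact Subtype.ext (mul_right_cancel₀ h2 (by linarith))
  · intro u v h w t hw
    simp only [Path.segment_apply, key, pos, Prod.mk.injEq] at hw
    have h2 : g v - g u ≠ 0 := sub_ne_zero.2 fun h' => h.ne (hg h'.symm)
    obtain ⟨p, q⟩ := hw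
    rw [← p] at q
    have h3 : (t : ℝ) * (1 - t) * (g v - g u) ^ 2 = 0 := by linear_combination q
    rcases mul_eq_zero.1 ((mul_eq_zero.1 h3).resolve_right (pow_ne_zero 2 h2)) with h4 | h4
    · exact Or.inl (Subtype.ext h4)
    · exact Or.inr (Subtype.ext (by simpa using (sub_eq_zero.1 h4).symm))

end Drawing

lemma excess_crossingNumber_le {V : Type*} [Fintype V] (G : SimpleGraph V) (hG : G.Colorable 2)
    (hV : 21 ≤ Fintype.card V) :
    2 * (3 * (G.edgeSet.ncard : ℤ) - crossingNumber G) ≤ 17 * Fintype.card V - 38 := by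
  have hne : {n : ℕ | ∃ D : Drawing G, D.crossCount = n}.Nonempty := by
    obtain ⟨D⟩ := Drawing.nonempty_of_finite G
    exact ⟨_, D, rfl⟩
  obtain ⟨D, hD⟩ := Nat.sInf_mem hne
  have h := D.excess_le hG (by omega)
  rw [hD] at h
  change 81 * (3 * (G.edgeSet.ncard : ℤ) - crossingNumber G) ≤ _ at h
  omega

/-- For every bipartite graph `G` with `n ≥ 4` vertices and `m` edges,
`cr₂(G) ≥ 3m − 17n + 38`. -/
theorem bipartite_cr2_lower_bound {V : Type} [Fintype V] (G : SimpleGraph V)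
    (hbip : G.Colorable 2) (hn : 4 ≤ Fintype.card V) :
    3 * (G.edgeSet.ncard : ℤ) - 17 * (Fintype.card V : ℤ) + 38
      ≤ (kCrossingNumber 2 G : ℤ) := by
  rcases le_or_gt (Fintype.card V) 20 with hle | hlt
  · have h1 : 4 * G.edgeSet.ncard ≤ Fintype.card V ^ 2 := by
      have h := SimpleGraph.IsBipartite.four_mul_encard_edgeSet_le (G := G) hbip
      rw [← (Set.toFinite G.edgeSet).cast_ncard_eq, ENat.card_eq_coe_fintype_card] at h
      exact_mod_cast h
    zify at h1 hn hle
    nlinarith [Int.natCast_nonneg (kCrossingNumber 2 G)]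
  have hne : {n : ℕ | ∃ f : Fin 2 → SimpleGraph V, (⨆ i, f i) = G ∧
      (∀ i j : Fin 2, i ≠ j → Disjoint (f i).edgeSet (f j).edgeSet) ∧
      n = ∑ i : Fin 2, crossingNumber (f i)}.Nonempty := by
    refine ⟨_, ![G, ⊥], ?_, ?_, rfl⟩
    · refine le_antisymm (iSup_le fun i => ?_) (le_iSup (![G, ⊥] : Fin 2 → SimpleGraph V) 0)
      fin_cases i <;> simp
    · intro i j hij
      fin_cases i <;> fin_cases j <;> simp_all
  obtain ⟨f, hf, -, hsum⟩ := Nat.sInf_mem hne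
  change kCrossingNumber 2 G = _ at hsum
  rw [Fin.sum_univ_two] at hsum
  have hcol : ∀ i, (f i).Colorable 2 := fun i => hbip.mono_left (hf ▸ le_iSup f i)
  have h0 := excess_crossingNumber_le (f 0) (hcol 0) hlt
  have h1 := excess_crossingNumber_le (f 1) (hcol 1) hlt
  have hm : G.edgeSet.ncard ≤ (f 0).edgeSet.ncard + (f 1).edgeSet.ncard := by
    rw [← hf, SimpleGraph.edgeSet_iSup]
    refine (Set.ncard_iUnion_le_of_fintype _).trans ?_
    rw [Fin.sum_univ_two]
  omega
end
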